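/- arXiv:0809.4519 — 5 statements merged into one kernel-verified Lean document; each statement's English description precedes it below -/
import Mathlib

section
/- Let f : [0,1] → ℝ^n be a curve with f(0) = 0 which is twice continuously differentiable, and suppose f'(0) is (c,q)-badly approximable by rationals. Then there exists a constant C > 0, depending only on c, q, n and f, such that for every ε > 0 and every λ ≥ A(ε), where A(ε) = C ε^{-((q+1)n(n+1) + q ∑_{i=0}^{n-2} (i+1)(2n-i) + 1)}, the projection of λ f([0,1]) to 𝕋^n = ℝ^n/ℤ^n is ε-dense (every point of 𝕋^n is within distance ε of some point of the projected curve). -/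
open Finset

/-- `x ∈ ℝ^n` is `(c,q)`-badly approximable by rationals: for every `ν ∈ ℤ^n \ {0}`,
`‖⟨x,ν⟩‖_𝕋 > c/‖ν‖^q`, where `‖z‖_𝕋` is the distance to the nearest integer and `‖ν‖` is
the `ℓ¹`-norm. -/
def IsBAP {n : ℕ} (c : ℝ) (q : ℕ) (x : Fin n → ℝ) : Prop :=
  ∀ ν : Fin n → ℤ, ν ≠ 0 →
    c / (∑ i, |(ν i : ℝ)|) ^ q <
      |(∑ i, x i * (ν i : ℝ)) - round (∑ i, x i * (ν i : ℝ))|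

/-- A power of `(1 + cos θ) / 2` is a trigonometric polynomial with binomial coefficients. -/
theorem half_one_add_cos_pow_eq_sum (N : ℕ) (θ : ℝ) :
    (((1 + Real.cos θ) / 2 : ℝ) : ℂ) ^ N =
      ∑ k ∈ range (2 * N + 1), (((2 * N).choose k / 4 ^ N : ℝ) : ℂ) *
        Complex.exp (Complex.I * ((((k : ℤ) - N : ℤ) : ℝ) * θ : ℝ)) := by
  have h1 : (((1 + Real.cos θ) / 2 : ℝ) : ℂ) =
      (Complex.exp (Complex.I * (θ / 2)) + Complex.exp (-(Complex.I * (θ / 2)))) ^ 2 / 4 := by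
    have h2 : Complex.exp (Complex.I * (θ / 2)) * Complex.exp (-(Complex.I * (θ / 2))) = 1 := by
      rw [← Complex.exp_add]; simp
    have h3 : Complex.exp (Complex.I * (θ / 2)) ^ 2 = Complex.exp (θ * Complex.I) := by
      rw [← Complex.exp_nat_mul]; congr 1; push_cast; ring
    have h4 : Complex.exp (-(Complex.I * (θ / 2))) ^ 2 = Complex.exp (-θ * Complex.I) := by
      rw [← Complex.exp_nat_mul]; congr 1; push_cast; ring
    push_cast
    rw [Complex.cos, add_sq, h3, h4, mul_assoc, h2]
    ring
  rw [h1, div_pow, ← pow_mul, add_pow, sum_div]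
  refine sum_congr rfl fun k hk => ?_
  have hk' : k ≤ 2 * N := by simpa [Nat.lt_succ_iff] using hk
  rw [← Complex.exp_nat_mul, ← Complex.exp_nat_mul, ← Complex.exp_add]
  have : (k : ℂ) * (Complex.I * (θ / 2)) + ((2 * N - k : ℕ) : ℂ) * (-(Complex.I * (θ / 2))) =
      Complex.I * ((((k : ℤ) - N : ℤ) : ℝ) * θ : ℝ) := by
    push_cast [Nat.cast_sub hk']; ring
  rw [this]
  push_cast
  ring

theorem one_le_centralBinom_sq_mul {N : ℕ} (hN : 1 ≤ N) :
    1 ≤ ((N.centralBinom : ℝ) / 4 ^ N) ^ 2 * (4 * N) := by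
  induction N, hN using Nat.le_induction with
  | base => norm_num [Nat.centralBinom, Nat.choose]
  | succ N hN ih =>
    refine ih.trans ?_
    have h := Nat.succ_mul_centralBinom_succ N
    have h' : ((N : ℝ) + 1) * ((N + 1).centralBinom : ℝ) = 2 * (2 * N + 1) * N.centralBinom := by
      exact_mod_cast h
    have hN0 : (0 : ℝ) < N + 1 := by positivity
    have h2 : ((N + 1).centralBinom : ℝ) / 4 ^ (N + 1) =
        (2 * N + 1) / (2 * (N + 1)) * (N.centralBinom / 4 ^ N) := by
      have h3 : ((N + 1).centralBinom : ℝ) = 2 * (2 * N + 1) * N.centralBinom / (N + 1) := by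
        rw [eq_div_iff hN0.ne', mul_comm, h']
      rw [h3, pow_succ]
      field_simp
      ring
    rw [h2, mul_pow, mul_comm (_ ^ 2) (_ ^ 2), mul_assoc (((N.centralBinom : ℝ) / 4 ^ N) ^ 2)]
    refine mul_le_mul_of_nonneg_left ?_ (sq_nonneg _)
    rw [div_pow, div_mul_eq_mul_div, le_div_iff₀ (by positivity)]
    push_cast
    nlinarith

/-- A finite sum of exponentials with nonnegative coefficients of total mass one, all of whose
frequencies but one are at least `δ` in absolute value, has integral over `[0, T]` within `2 / δ`
of the contribution of its constant term. -/
theorem norm_integral_sum_exp_sub_le {ι : Type*} (S : Finset ι) (A a b : ι → ℝ) (j : ι)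
    (hj : j ∈ S) (hA : ∀ i ∈ S, 0 ≤ A i) (hA1 : ∑ i ∈ S, A i = 1) (haj : a j = 0) (hbj : b j = 0)
    {δ : ℝ} (hδ : 0 < δ) (ha : ∀ i ∈ S, i ≠ j → δ ≤ |a i|) (T : ℝ) :
    ‖(∫ s in (0 : ℝ)..T, ∑ i ∈ S, (A i : ℂ) * Complex.exp (Complex.I * (a i * s + b i : ℝ)))
      - T * A j‖ ≤ 2 / δ := by
  classical
  rw [intervalIntegral.integral_finsetSum
    (fun i _ => (by fun_prop : Continuous _).intervalIntegrable _ _),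
    ← add_sum_erase _ _ hj]
  have h0 : (∫ s in (0 : ℝ)..T, (A j : ℂ) * Complex.exp (Complex.I * (a j * s + b j : ℝ))) =
      T * A j := by
    simp [haj, hbj]
  rw [h0, add_sub_cancel_left]
  calc _ ≤ ∑ i ∈ S.erase j, A i * (2 / δ) := by
        refine norm_sum_le_of_le _ fun i hi => ?_
        obtain ⟨hij, hi⟩ := mem_erase.mp hi
        have hai := ha i hi hij
        have hai0 : a i ≠ 0 := fun h => by rw [h, abs_zero] at hai; linarith
        have hc : Complex.I * (a i : ℂ) ≠ 0 := by simp [hai0]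
        have he : ∀ s : ℝ, (A i : ℂ) * Complex.exp (Complex.I * (a i * s + b i : ℝ)) =
            (A i * Complex.exp (Complex.I * (b i : ℝ))) * Complex.exp (Complex.I * a i * s) := by
          intro s
          rw [mul_assoc, ← Complex.exp_add]
          congr 2
          push_cast; ring
        simp_rw [he]
        rw [intervalIntegral.integral_const_mul, integral_exp_mul_complex hc, norm_mul, norm_mul,
          norm_div, mul_comm Complex.I (b i : ℂ), Complex.norm_exp_ofReal_mul_I, mul_one,
          Complex.norm_real, Real.norm_of_nonneg (hA i hi)]
        refine mul_le_mul_of_nonneg_left ?_ (hA i hi)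
        have hn : ‖Complex.I * (a i : ℂ)‖ = |a i| := by simp
        rw [hn]
        have hr : ∀ s : ℝ, Complex.I * a i * s = (a i * s : ℝ) * Complex.I := by
          intro s; push_cast; ring
        refine div_le_div₀ (by norm_num) ?_ hδ hai
        refine (norm_sub_le _ _).trans ?_
        rw [hr, hr, Complex.norm_exp_ofReal_mul_I, Complex.norm_exp_ofReal_mul_I]
        norm_num
    _ = (∑ i ∈ S.erase j, A i) * (2 / δ) := (sum_mul ..).symm
    _ ≤ 1 * (2 / δ) := by
        refine mul_le_mul_of_nonneg_right ?_ (by positivity)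
        rw [← hA1]
        exact sum_le_sum_of_subset_of_nonneg (erase_subset _ _) fun i hi _ => hA i hi
    _ = 2 / δ := one_mul _

/-- Effective equidistribution of a segment in a badly approximable direction, tested against a
product of powers of `(1 + cos) / 2` centred at `z`. -/
theorem abs_integral_prod_cos_kernel_sub_le {n : ℕ} {c : ℝ} (hc : 0 < c) {q : ℕ}
    {v : Fin n → ℝ}
    (hv : ∀ ν : Fin n → ℤ, ν ≠ 0 → c / (∑ i, |(ν i : ℝ)|) ^ q < |∑ i, v i * (ν i : ℝ)|)
    {N : ℕ} (hn : 0 < n) (hN : 0 < N) (z : Fin n → ℝ) (T : ℝ) :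
    |(∫ s in (0 : ℝ)..T, ∏ i, ((1 + Real.cos (2 * Real.pi * (s * v i - z i))) / 2) ^ N)
      - T * ((N.centralBinom : ℝ) / 4 ^ N) ^ n| ≤ (n * N : ℝ) ^ q / (Real.pi * c) := by
  classical
  let S : Finset (Fin n → ℕ) := Fintype.piFinset fun _ => range (2 * N + 1)
  let A : (Fin n → ℕ) → ℝ := fun κ => ∏ i, ((2 * N).choose (κ i) / 4 ^ N : ℝ)
  let ν : (Fin n → ℕ) → Fin n → ℤ := fun κ i => (κ i : ℤ) - N
  let a : (Fin n → ℕ) → ℝ := fun κ => 2 * Real.pi * ∑ i, v i * (ν κ i : ℝ)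
  let b : (Fin n → ℕ) → ℝ := fun κ => -(2 * Real.pi * ∑ i, z i * (ν κ i : ℝ))
  have hpi := Real.pi_pos
  have hexp : ∀ s : ℝ,
      ((∏ i, ((1 + Real.cos (2 * Real.pi * (s * v i - z i))) / 2) ^ N : ℝ) : ℂ) =
      ∑ κ ∈ S, (A κ : ℂ) * Complex.exp (Complex.I * (a κ * s + b κ : ℝ)) := by
    intro s
    rw [Complex.ofReal_prod]
    simp_rw [Complex.ofReal_pow, half_one_add_cos_pow_eq_sum]
    rw [prod_univ_sum]
    refine sum_congr rfl fun κ _ => ?_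
    rw [prod_mul_distrib, ← Complex.exp_sum, ← mul_sum, ← Complex.ofReal_prod,
      ← Complex.ofReal_sum]
    congr 5
    simp only [a, b, ν, mul_sum, sum_mul, ← sum_neg_distrib, ← sum_add_distrib]
    exact sum_congr rfl fun i _ => by ring
  have hA1 : ∑ κ ∈ S, A κ = 1 := by
    have := prod_univ_sum (fun _ : Fin n => range (2 * N + 1))
      (fun _ k => ((2 * N).choose k / 4 ^ N : ℝ))
    rw [← this]
    refine prod_eq_one fun i _ => ?_
    rw [← sum_div, ← Nat.cast_sum, Nat.sum_range_choose, pow_mul]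
    norm_num
  have main := norm_integral_sum_exp_sub_le S A a b (fun _ => N)
    (by simp [S]; omega) (fun κ _ => prod_nonneg fun i _ => by positivity) hA1
    (by simp [a, ν]) (by simp [b, ν]) (δ := 2 * Real.pi * (c / (n * N : ℝ) ^ q)) (by positivity)
    (by
      intro κ hκ hne
      have hν : ν κ ≠ 0 := by
        intro h
        apply hne
        funext i
        have := congrFun h i
        simp only [ν, Pi.zero_apply] at this
        omega
      have hle : ∑ i, |(ν κ i : ℝ)| ≤ n * N := by
        have : ∀ i ∈ (univ : Finset (Fin n)), |(ν κ i : ℝ)| ≤ N := by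
          intro i _
          have hi := Fintype.mem_piFinset.mp hκ i
          rw [mem_range] at hi
          have : |ν κ i| ≤ (N : ℤ) := abs_le.mpr (by simp only [ν]; omega)
          exact_mod_cast this
        simpa using sum_le_sum this
      have hpos : 0 < ∑ i, |(ν κ i : ℝ)| := by
        obtain ⟨i, hi⟩ := Function.ne_iff.mp hν
        refine sum_pos' (fun _ _ => abs_nonneg _) ⟨i, mem_univ _, abs_pos.mpr ?_⟩
        exact_mod_cast hi
      simp only [a]
      rw [abs_mul, abs_of_pos (by positivity : 0 < 2 * Real.pi)]
      refine mul_le_mul_of_nonneg_left (le_trans ?_ (hv _ hν).le) (by positivity)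
      exact div_le_div_of_nonneg_left hc.le (by positivity) (by gcongr)) T
  have hAj : A (fun _ => N) = ((N.centralBinom : ℝ) / 4 ^ N) ^ n := by
    simp [A, Nat.centralBinom, div_pow]
  simp_rw [← hexp] at main
  rw [intervalIntegral.integral_ofReal, hAj, ← Complex.ofReal_mul, ← Complex.ofReal_sub,
    Complex.norm_real, Real.norm_eq_abs] at main
  refine main.trans (le_of_eq ?_)
  field_simp

theorem half_one_add_cos_le_exp (x : ℝ) :
    (1 + Real.cos (2 * Real.pi * x)) / 2 ≤ Real.exp (-4 * ‖(x : AddCircle (1 : ℝ))‖ ^ 2) := by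
  rw [UnitAddCircle.norm_eq]
  set y := x - round x with hy
  have hc : Real.cos (2 * Real.pi * x) = Real.cos (2 * Real.pi * y) := by
    rw [hy, mul_sub, mul_comm (2 * Real.pi) (round x : ℝ), Real.cos_sub_int_mul_two_pi]
  have hy2 : |y| ≤ 1 / 2 := abs_sub_round x
  have hs := Real.mul_abs_le_abs_sin (x := Real.pi * y)
    (by rw [abs_mul, abs_of_pos Real.pi_pos]; nlinarith [Real.pi_pos])
  rw [abs_mul, abs_of_pos Real.pi_pos, ← mul_assoc, div_mul_cancel₀ _ Real.pi_ne_zero] at hs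
  have hs2 : (2 * |y|) ^ 2 ≤ Real.sin (Real.pi * y) ^ 2 := by
    rw [← sq_abs (Real.sin _)]; gcongr
  have h2 : Real.cos (2 * Real.pi * y) = 1 - 2 * Real.sin (Real.pi * y) ^ 2 := by
    rw [mul_assoc, Real.cos_two_mul, Real.cos_sq']; ring
  rw [hc, h2]
  have := Real.add_one_le_exp (-4 * |y| ^ 2)
  nlinarith

/-- If integer combinations of the coordinates of `v` are bounded away from `0` polynomially, then
sufficiently long segments in the direction `v` come `ε`-close to every point modulo `ℤ^n`. -/
theorem exists_line_near_of_mul_pow_lt {n : ℕ} {c : ℝ} (hc : 0 < c) {q : ℕ} {v : Fin n → ℝ}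
    (hv : ∀ ν : Fin n → ℤ, ν ≠ 0 → c / (∑ i, |(ν i : ℝ)|) ^ q < |∑ i, v i * (ν i : ℝ)|)
    (hn : 0 < n) :
    ∃ C > 0, ∀ ε : ℝ, 0 < ε → ε ≤ 1 → ∀ T : ℝ, 0 ≤ T → C < T ^ 2 * ε ^ (6 * q + 3 * n) →
      ∀ z : Fin n → ℝ, ∃ s ∈ Set.Icc (0 : ℝ) T, ∀ i,
        ‖((s * v i - z i : ℝ) : AddCircle (1 : ℝ))‖ ≤ ε := by
  obtain ⟨M, hM⟩ := Filter.eventually_atTop.mp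
    ((Real.tendsto_pow_mul_exp_neg_atTop_nhds_zero (3 * n)).eventually_lt_const
      (by positivity : (0 : ℝ) < ((4 : ℝ) ^ (n + 1))⁻¹))
  set M' : ℝ := max M 1
  have hM1 : 1 ≤ M' := le_max_right _ _
  have hpi := Real.pi_pos
  refine ⟨4 ^ (n + 1) * (n ^ q / (Real.pi * c)) ^ 2 * (M' + 1) ^ (6 * q + 3 * n), by positivity, ?_⟩
  intro ε hε hε1 T hT0 hT z
  set k : ℕ := ⌈M' / ε⌉₊
  have hkM : M' / ε ≤ k := Nat.le_ceil _
  have hk : (k : ℝ) ≤ (M' + 1) / ε := by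
    have h1 : (k : ℝ) < M' / ε + 1 := Nat.ceil_lt_add_one (by positivity)
    have h2 : 1 ≤ 1 / ε := by rw [le_div_iff₀ hε]; linarith
    rw [add_div]; linarith
  have hεk : M' ≤ k * ε := (div_le_iff₀ hε).mp hkM
  have hkM' : M' ≤ k := hεk.trans (mul_le_of_le_one_right (by positivity) hε1)
  have hk1 : (1 : ℝ) ≤ k := hM1.trans hkM'
  have hk0 : 0 < k := by exact_mod_cast (zero_lt_one.trans_le hk1)
  set N : ℕ := k ^ 3 with hN
  have hN0 : 0 < N := by positivity
  have hNk : (N : ℝ) = (k : ℝ) ^ 3 := by simp [hN]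
  set W : ℝ := ((N.centralBinom : ℝ) / 4 ^ N) ^ n with hW
  have hW0 : 0 < W := by
    have := N.centralBinom_pos
    positivity
  have hW2 : 1 ≤ W ^ 2 * (4 ^ n * (k : ℝ) ^ (3 * n)) := by
    have := one_le_pow₀ (n := n) (one_le_centralBinom_sq_mul hN0)
    rw [hNk] at this
    calc _ ≤ _ := this
      _ = _ := by rw [hW]; ring
  set B : ℝ := (n * N : ℝ) ^ q / (Real.pi * c) with hB
  have hB0 : 0 < B := by positivity
  have hexpW : Real.exp (-4 * ε ^ 2) ^ N ≤ W / 2 := by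
    rw [← Real.exp_nat_mul]
    refine (pow_le_pow_iff_left₀ (by positivity) (by positivity) two_ne_zero).mp ?_
    have h1 : Real.exp (N * (-4 * ε ^ 2)) ^ 2 ≤ Real.exp (-k) := by
      rw [← Real.exp_nat_mul, Real.exp_le_exp, hNk]
      have : (1 : ℝ) ≤ (k * ε) ^ 2 := one_le_pow₀ (hM1.trans hεk)
      push_cast
      nlinarith
    have h2 : (k : ℝ) ^ (3 * n) * Real.exp (-k) ≤ ((4 : ℝ) ^ (n + 1))⁻¹ :=
      (hM k ((le_max_left _ _).trans hkM')).le
    refine h1.trans ?_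
    rw [div_pow, le_div_iff₀ (by norm_num)]
    refine le_of_mul_le_mul_right ?_ (by positivity : (0 : ℝ) < 4 ^ n * (k : ℝ) ^ (3 * n))
    refine le_trans ?_ hW2
    calc _ = 4 ^ (n + 1) * ((k : ℝ) ^ (3 * n) * Real.exp (-k)) := by ring
      _ ≤ 4 ^ (n + 1) * ((4 : ℝ) ^ (n + 1))⁻¹ := by gcongr
      _ = 1 := by field_simp
  have hTB : B < T * W / 2 := by
    refine lt_of_pow_lt_pow_left₀ 2 (by positivity) ?_
    have h1 : B ^ 2 * (4 * (4 ^ n * (k : ℝ) ^ (3 * n))) < T ^ 2 := by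
      calc _ = 4 ^ (n + 1) * (n ^ q / (Real.pi * c)) ^ 2 * (k : ℝ) ^ (6 * q + 3 * n) := by
            rw [hB, hNk]; ring
        _ ≤ 4 ^ (n + 1) * (n ^ q / (Real.pi * c)) ^ 2 * ((M' + 1) / ε) ^ (6 * q + 3 * n) := by
            gcongr
        _ < T ^ 2 := by
            rw [div_pow (M' + 1), ← mul_div_assoc, div_lt_iff₀ (by positivity)]
            exact hT
    have h2 : B ^ 2 * 4 < T ^ 2 * W ^ 2 := by
      calc B ^ 2 * 4 ≤ B ^ 2 * 4 * (W ^ 2 * (4 ^ n * (k : ℝ) ^ (3 * n))) :=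
            le_mul_of_one_le_right (by positivity) hW2
        _ = B ^ 2 * (4 * (4 ^ n * (k : ℝ) ^ (3 * n))) * W ^ 2 := by ring
        _ < T ^ 2 * W ^ 2 := by gcongr
    rw [div_pow (T * W), mul_pow T, lt_div_iff₀ (by norm_num)]
    linarith
  by_contra! hcon
  have hmain := abs_integral_prod_cos_kernel_sub_le hc hv hn hN0 z T
  have hup : (∫ s in (0 : ℝ)..T,
      ∏ i, ((1 + Real.cos (2 * Real.pi * (s * v i - z i))) / 2) ^ N) ≤ T * (W / 2) := by
    have h := intervalIntegral.integral_mono_on (μ := MeasureTheory.volume)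
      (f := fun s => ∏ i, ((1 + Real.cos (2 * Real.pi * (s * v i - z i))) / 2) ^ N)
      (g := fun _ => W / 2) hT0
      ((by fun_prop : Continuous _).intervalIntegrable _ _) (by simp) ?_
    · simpa [mul_div_assoc] using h
    intro s hs
    obtain ⟨i, hi⟩ := hcon s hs
    have hf0 : ∀ j, 0 ≤ (1 + Real.cos (2 * Real.pi * (s * v j - z j))) / 2 := fun j => by
      linarith [Real.neg_one_le_cos (2 * Real.pi * (s * v j - z j))]
    have hf1 : ∀ j, (1 + Real.cos (2 * Real.pi * (s * v j - z j))) / 2 ≤ 1 := fun j => by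
      linarith [Real.cos_le_one (2 * Real.pi * (s * v j - z j))]
    rw [← mul_prod_erase univ _ (mem_univ i)]
    refine (mul_le_of_le_one_right (pow_nonneg (hf0 i) _) (prod_le_one
      (fun j _ => pow_nonneg (hf0 j) _) fun j _ => pow_le_one₀ (hf0 j) (hf1 j))).trans ?_
    refine le_trans (pow_le_pow_left₀ (hf0 i) ((half_one_add_cos_le_exp _).trans ?_) N) hexpW
    rw [Real.exp_le_exp]
    have := pow_le_pow_left₀ hε.le hi.le 2
    linarith
  have := (abs_le.mp hmain).1
  linarith

theorem exists_line_near_circle {v : ℝ} (hv : v ≠ 0) {T : ℝ} (hT : 1 ≤ T * |v|) (z : ℝ) :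
    ∃ s ∈ Set.Icc (0 : ℝ) T, ((s * v - z : ℝ) : AddCircle (1 : ℝ)) = 0 := by
  have hv0 := abs_pos.mpr hv
  refine ⟨Int.fract (SignType.sign v * z) / |v|, ⟨by positivity, ?_⟩, ?_⟩
  · rw [div_le_iff₀ hv0]
    exact (Int.fract_lt_one _).le.trans hT
  · rw [AddCircle.coe_eq_zero_iff]
    rcases hv.lt_or_gt with h | h
    · refine ⟨⌊-z⌋, ?_⟩
      rw [zsmul_one, sign_neg h, abs_of_neg h, div_mul_eq_mul_div, mul_comm, div_neg, mul_comm,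
        mul_div_assoc, div_self hv]
      simp only [Int.fract, SignType.coe_neg_one, neg_one_mul]
      ring
    · refine ⟨-⌊z⌋, ?_⟩
      rw [zsmul_one, sign_pos h, abs_of_pos h, div_mul_cancel₀ _ hv]
      simp only [Int.fract, SignType.coe_one, one_mul]
      push_cast
      ring

theorem IsBAP.div_pow_lt_abs {n : ℕ} {c : ℝ} {q : ℕ} {x : Fin n → ℝ} (h : IsBAP c q x)
    (ν : Fin n → ℤ) (hν : ν ≠ 0) : c / (∑ i, |(ν i : ℝ)|) ^ q < |∑ i, x i * (ν i : ℝ)| :=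
  (h ν hν).trans_le (by simpa using round_le (∑ i, x i * (ν i : ℝ)) 0)

/-- A segment in a badly approximable direction is `ε`-dense modulo `ℤ^n` once its length
exceeds a suitable negative power of `ε`. -/
theorem IsBAP.exists_line_near {n : ℕ} {c : ℝ} (hc : 0 < c) {q : ℕ} {v : Fin n → ℝ}
    (h : IsBAP c q v) {D : ℕ} (hD : 2 ≤ n → 6 * q + 3 * n ≤ D) :
    ∃ C > 0, ∀ ε : ℝ, 0 < ε → ε ≤ 1 → ∀ T : ℝ, 0 ≤ T → C < T ^ 2 * ε ^ D →
      ∀ z : Fin n → ℝ, ∃ s ∈ Set.Icc (0 : ℝ) T, ∀ i,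
        ‖((s * v i - z i : ℝ) : AddCircle (1 : ℝ))‖ ≤ ε := by
  match n, v, h, hD with
  | 0, v, h, hD => exact ⟨1, one_pos, fun ε _ _ T hT _ z => ⟨0, ⟨le_rfl, hT⟩, fun i => i.elim0⟩⟩
  | 1, v, h, hD =>
    have hv : v 0 ≠ 0 := by
      intro h0
      have := h.div_pow_lt_abs 1 one_ne_zero
      simp [h0] at this
      linarith
    refine ⟨(|v 0| ^ 2)⁻¹, by positivity, fun ε hε hε1 T hT hC z => ?_⟩
    have hT1 : 1 ≤ T * |v 0| := by
      rw [← one_le_sq_iff₀ (by positivity), mul_pow]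
      have h1 := hC.le.trans (mul_le_of_le_one_right (by positivity) (pow_le_one₀ hε.le hε1))
      rwa [inv_le_iff_one_le_mul₀ (by positivity)] at h1
    obtain ⟨s, hs, h0⟩ := exists_line_near_circle hv hT1 (z 0)
    refine ⟨s, hs, fun i => ?_⟩
    rw [Subsingleton.elim i 0, h0, norm_zero]
    exact hε.le
  | n + 2, v, h, hD =>
    obtain ⟨C, hC, H⟩ := exists_line_near_of_mul_pow_lt hc h.div_pow_lt_abs (by omega)
    refine ⟨C, hC, fun ε hε hε1 T hT hCT => H ε hε hε1 T hT (hCT.trans_le ?_)⟩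
    exact mul_le_mul_of_nonneg_left (pow_le_pow_of_le_one hε.le hε1 (hD (by omega)))
      (by positivity)

theorem exists_norm_sub_smul_derivWithin_le {E : Type*} [NormedAddCommGroup E] [NormedSpace ℝ E]
    {f : ℝ → E} (hf : ContDiffOn ℝ 2 f (Set.Icc (0 : ℝ) 1)) (hf0 : f 0 = 0) :
    ∃ K > 0, ∀ t ∈ Set.Icc (0 : ℝ) 1,
      ‖f t - t • derivWithin f (Set.Icc (0 : ℝ) 1) 0‖ ≤ K * t ^ 2 := by
  obtain ⟨K, hK⟩ := exists_taylor_mean_remainder_bound (n := 1) zero_le_one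
    (by norm_num; exact hf)
  refine ⟨max K 1, by positivity, fun t ht => ?_⟩
  have h := hK t ht
  rw [taylorWithinEval_succ, taylor_within_zero_eval, iteratedDerivWithin_one, hf0] at h
  simp only [zero_add, sub_zero, Nat.reduceAdd] at h
  norm_num at h
  exact h.trans (by gcongr; exact le_max_left _ _)

/-- Let `f : [0,1] → ℝ^n` be a twice continuously differentiable curve with `f(0) = 0` whose
derivative `f'(0)` is `(c,q)`-badly approximable by rationals. Then there is a constant
`C > 0` (depending only on `c, q, n, f`) such that for every `ε > 0` and every
`λ ≥ A(ε) = C ε^{-((q+1)n(n+1) + q ∑_{i=0}^{n-2} (i+1)(2n-i) + 1)}`, the projection of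
`λ f([0,1])` to `𝕋^n = ℝ^n/ℤ^n` is `ε`-dense. -/
theorem dilated_curve_eps_dense (n : ℕ) (c : ℝ) (hc : 0 < c) (q : ℕ)
    (f : ℝ → (Fin n → ℝ)) (hf : ContDiffOn ℝ 2 f (Set.Icc (0:ℝ) 1))
    (hf0 : f 0 = 0)
    (hbap : IsBAP c q (derivWithin f (Set.Icc (0:ℝ) 1) 0)) :
    ∃ C > 0, ∀ ε : ℝ, 0 < ε → ∀ lam : ℝ,
      C * ε ^ (-(((q + 1) * n * (n + 1) + q * ∑ i ∈ Finset.range (n - 1),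
          (i + 1) * (2 * n - i) + 1 : ℕ) : ℝ)) ≤ lam →
      ∀ z : Fin n → AddCircle (1 : ℝ), ∃ t ∈ Set.Icc (0:ℝ) 1,
        dist (fun i => ((lam * f t i : ℝ) : AddCircle (1 : ℝ))) z ≤ ε := by
  set D : ℕ := (q + 1) * n * (n + 1) + q * ∑ i ∈ Finset.range (n - 1), (i + 1) * (2 * n - i)
  have hD : 2 ≤ n → 6 * q + 3 * n ≤ D := by
    intro hn
    refine le_trans ?_ (Nat.le_add_right _ _)
    calc 6 * q + 3 * n ≤ (q + 1) * n * 3 := by nlinarith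
      _ ≤ (q + 1) * n * (n + 1) := by gcongr; omega
  set v := derivWithin f (Set.Icc (0:ℝ) 1) 0
  obtain ⟨C₀, hC₀, hline⟩ := hbap.exists_line_near hc hD
  obtain ⟨K, hK, htaylor⟩ := exists_norm_sub_smul_derivWithin_le hf hf0
  refine ⟨max (2 * K * (2 * C₀) * 2 ^ D) (1 / K), by positivity, fun ε hε lam hlam z => ?_⟩
  rw [Real.rpow_neg hε.le, Real.rpow_natCast, ← div_eq_mul_inv, div_le_iff₀ (by positivity),
    max_le_iff] at hlam
  obtain ⟨hlam1, hlam2⟩ := hlam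
  have hlam0 : 0 < lam :=
    pos_of_mul_pos_left ((by positivity : 0 < 1 / K).trans_le hlam2) (by positivity)
  rcases le_or_gt 1 ε with hε1 | hε1
  · refine ⟨0, by simp, (dist_pi_le_iff hε.le).mpr fun i => ?_⟩
    rw [dist_eq_norm]
    refine (AddCircle.norm_le_half_period 1 one_ne_zero).trans ?_
    rw [abs_one]; linarith
  set τ : ℝ := Real.sqrt (ε / (2 * K * lam))
  have hτ2 : τ ^ 2 = ε / (2 * K * lam) := Real.sq_sqrt (by positivity)
  have hτ1 : τ ≤ 1 := by
    rw [← sq_le_one_iff₀ (Real.sqrt_nonneg _), hτ2, div_le_one (by positivity)]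
    rw [div_le_iff₀ hK] at hlam2
    have : lam * ε ^ (D + 1) ≤ lam := mul_le_of_le_one_right hlam0.le (pow_le_one₀ hε.le hε1.le)
    nlinarith
  choose y hy using fun i => QuotientAddGroup.mk_surjective (z i)
  obtain ⟨s, ⟨hs0, hsT⟩, hs⟩ := hline (ε / 2) (by positivity) (by linarith) (lam * τ)
    (by positivity) (by
      rw [mul_pow, hτ2, div_pow]
      have : lam ^ 2 * (ε / (2 * K * lam)) * (ε ^ D / 2 ^ D) =
          lam * ε ^ (D + 1) / (2 * K * 2 ^ D) := by
        field_simp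
        ring
      rw [this, lt_div_iff₀ (by positivity)]
      refine lt_of_lt_of_le ?_ hlam1
      have : 0 < K * C₀ * 2 ^ D := by positivity
      linarith) y
  set t := s / lam
  have hst : s = lam * t := by simp only [t]; field_simp
  have ht0 : 0 ≤ t := by positivity
  have htτ : t ≤ τ := by rwa [hst, mul_le_mul_iff_right₀ hlam0] at hsT
  have ht : t ∈ Set.Icc (0 : ℝ) 1 := ⟨ht0, htτ.trans hτ1⟩
  refine ⟨t, ht, (dist_pi_le_iff hε.le).mpr fun i => ?_⟩
  have hsplit : ((lam * f t i : ℝ) : AddCircle (1 : ℝ)) - z i =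
      ((lam * (f t - t • v) i : ℝ) : AddCircle (1 : ℝ)) +
        ((s * v i - y i : ℝ) : AddCircle (1 : ℝ)) := by
    rw [← hy i, ← AddCircle.coe_add, hst]
    change _ - ((y i : ℝ) : AddCircle (1 : ℝ)) = _
    rw [← AddCircle.coe_sub]
    congr 1
    simp only [Pi.sub_apply, Pi.smul_apply, smul_eq_mul]
    ring
  rw [dist_eq_norm, hsplit]
  have h1 : ‖((lam * (f t - t • v) i : ℝ) : AddCircle (1 : ℝ))‖ ≤ ε / 2 := by
    refine QuotientAddGroup.norm_mk_le_norm.trans ?_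
    rw [norm_mul, Real.norm_of_nonneg hlam0.le]
    calc lam * ‖(f t - t • v) i‖ ≤ lam * (K * t ^ 2) := by
          gcongr
          exact (norm_le_pi_norm _ i).trans (htaylor t ht)
      _ ≤ lam * (K * τ ^ 2) := by gcongr
      _ = ε / 2 := by rw [hτ2]; field_simp
  linarith [norm_add_le ((lam * (f t - t • v) i : ℝ) : AddCircle (1 : ℝ))
    ((s * v i - y i : ℝ) : AddCircle (1 : ℝ)), hs i]
end

section
/- Let p : ℝ → ℝ^n be a polynomial curve with p_j(t) = ∑_{k=1}^{d} a_{jk} t^k for j = 1,…,n, and assume that the vector (a_{11}, a_{21}, …, a_{n1}) of linear coefficients is (c,q)-badly approximable by rationals. Then there exists C > 0 (depending on p, n, c, q) such that for every ε > 0 and every λ ≥ A(ε), where A(ε) = C ε^{-(2((q+1)n(n+1)/2 + q ∑_{i=0}^{n-2} (i+1)(2n-i)/2) + 1)}, the projection of λ p([0,1]) to 𝕋^n = ℝ^n/ℤ^n is ε-dense (every point of 𝕋^n is within distance ε of some point of the projected curve). -/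
open Finset Matrix

/-- Fourier expansion of the kernel `∏ j, cos (π x j) ^ (2 m)` on the torus. -/
theorem prod_cos_pow_eq_sum {n : ℕ} (m : ℕ) (x : Fin n → ℝ) :
    ∏ j, Real.cos (Real.pi * x j) ^ (2 * m) =
      ∑ k ∈ Fintype.piFinset (fun _ : Fin n => Finset.range (2 * m + 1)),
        (∏ j, ((2 * m).choose (k j) : ℝ) / 4 ^ m) *
          Real.cos (2 * Real.pi * ∑ j, x j * (k j - m)) := by
  have single (y : ℝ) : (Complex.cos (Real.pi * y)) ^ (2 * m) =
      ∑ k ∈ Finset.range (2 * m + 1), (((2 * m).choose k : ℂ) / 4 ^ m) *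
        Complex.exp ((2 * Real.pi * (y * (k - m)) : ℂ) * Complex.I) := by
    rw [Complex.cos, div_pow, add_pow, Finset.sum_div]
    refine Finset.sum_congr rfl fun k hk => ?_
    have hk' : k ≤ 2 * m := by simpa [Nat.lt_succ_iff] using hk
    rw [← Complex.exp_nat_mul, ← Complex.exp_nat_mul, ← Complex.exp_add, pow_mul]
    have : (k : ℂ) * (Real.pi * y * Complex.I) + ((2 * m - k : ℕ) : ℂ) *
        (-(Real.pi * y) * Complex.I) = (2 * Real.pi * (y * (k - m)) : ℂ) * Complex.I := by
      push_cast [Nat.cast_sub hk']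
      ring
    rw [this]
    norm_num
    ring
  have complexForm : ((∏ j, Real.cos (Real.pi * x j) ^ (2 * m) : ℝ) : ℂ) =
      ∑ k ∈ Fintype.piFinset (fun _ : Fin n => Finset.range (2 * m + 1)),
        ((∏ j, ((2 * m).choose (k j) : ℝ) / 4 ^ m : ℝ) : ℂ) *
          Complex.exp ((2 * Real.pi * ∑ j, x j * (k j - m) : ℝ) * Complex.I) := by
    push_cast
    simp_rw [single]
    rw [Finset.prod_univ_sum]
    refine Finset.sum_congr rfl fun k _ => ?_
    rw [Finset.prod_mul_distrib, ← Complex.exp_sum, Finset.mul_sum, Finset.sum_mul]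
  have h := congrArg Complex.re complexForm
  rw [Complex.ofReal_re, Complex.re_sum] at h
  rw [h]
  refine Finset.sum_congr rfl fun k _ => ?_
  rw [Complex.re_ofReal_mul, Complex.exp_ofReal_mul_I_re]

theorem sum_prod_choose_div_four_pow (n m : ℕ) :
    ∑ k ∈ Fintype.piFinset (fun _ : Fin n => Finset.range (2 * m + 1)),
      ∏ j, ((2 * m).choose (k j) : ℝ) / 4 ^ m = 1 := by
  have h := prod_cos_pow_eq_sum m (0 : Fin n → ℝ)
  simpa using h.symm

theorem abs_integral_cos_le {α : ℝ} (hα : α ≠ 0) (β T : ℝ) :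
    |∫ s in (0 : ℝ)..T, Real.cos (α * s + β)| ≤ 2 / |α| := by
  have h : ∫ s in (0 : ℝ)..T, Real.cos (α * s + β) =
      α⁻¹ * (Real.sin (α * T + β) - Real.sin β) := by
    rw [intervalIntegral.integral_comp_mul_add (fun u => Real.cos u) hα, integral_cos]
    simp
  rw [h, abs_mul, abs_inv, inv_mul_eq_div]
  gcongr
  refine (abs_sub _ _).trans ?_
  linarith [Real.abs_sin_le_one (α * T + β), Real.abs_sin_le_one β]

theorem cos_sq_le_of_lt_abs_sub_round {x ε : ℝ} (hε : 0 < ε) (hx : ε < |x - round x|) :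
    Real.cos (Real.pi * x) ^ 2 ≤ Real.exp (-(4 * ε ^ 2)) := by
  set y := x - round x with hy
  have hcos : Real.cos (2 * (Real.pi * x)) = Real.cos (2 * Real.pi * y) := by
    rw [← Real.cos_sub_int_mul_two_pi _ (round x), hy]
    congr 1
    ring
  have hyle : |y| ≤ 1 / 2 := abs_sub_round x
  have hpi := Real.pi_pos
  have h1 : Real.cos (2 * Real.pi * y) ≤ 1 - 2 / Real.pi ^ 2 * (2 * Real.pi * y) ^ 2 := by
    apply Real.cos_le_one_sub_mul_cos_sq
    rw [abs_mul, abs_of_pos (by positivity)]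
    nlinarith
  have h2 : 2 / Real.pi ^ 2 * (2 * Real.pi * y) ^ 2 = 8 * y ^ 2 := by
    field_simp
    ring
  have h3 : ε ^ 2 ≤ y ^ 2 := by
    rw [← sq_abs y]
    gcongr
  rw [Real.cos_sq, hcos]
  linarith [Real.add_one_le_exp (-(4 * ε ^ 2))]

theorem IsBAP.lt_abs {n : ℕ} {c : ℝ} {q : ℕ} {a : Fin n → ℝ} (h : IsBAP c q a)
    {ν : Fin n → ℤ} (hν : ν ≠ 0) :
    c / (∑ i, |(ν i : ℝ)|) ^ q < |∑ i, a i * (ν i : ℝ)| := by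
  simpa using (h ν hν).trans_le (round_le _ 0)

theorem IsBAP.exponent_pos {n : ℕ} {c : ℝ} (hc : 0 < c) {q : ℕ} {a : Fin n → ℝ}
    (h : IsBAP c q a) (hn : 0 < n) : 0 < q := by
  rw [Nat.pos_iff_ne_zero]
  rintro rfl
  obtain ⟨N, hN⟩ := exists_nat_gt (1 / c)
  have hNpos : (0 : ℝ) < N := (by positivity : 0 < 1 / c).trans hN
  obtain ⟨k, hk, -, hle⟩ := Real.exists_nat_abs_mul_sub_round_le (a ⟨0, hn⟩)
    (n := N) (by exact_mod_cast hNpos)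
  have hbap := h (Pi.single ⟨0, hn⟩ (k : ℤ)) (by simpa using hk.ne')
  simp only [pow_zero, div_one] at hbap
  rw [Finset.sum_eq_single ⟨0, hn⟩ (by
    intro b _ hb
    simp [hb]) (by simp)] at hbap
  simp only [Pi.single_eq_same, Int.cast_natCast] at hbap
  rw [mul_comm (a _)] at hbap
  have : 1 / ((N : ℝ) + 1) < c := by
    rw [div_lt_iff₀ hc] at hN
    rw [div_lt_iff₀ (by positivity)]
    nlinarith
  linarith

/-- Averaging along a linear flow: if the kernel is at most half of its mean on the segment
`[0, T]`, then `T` is bounded. -/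
theorem IsBAP.time_le {n : ℕ} {c : ℝ} (hc : 0 < c) {q : ℕ} {a : Fin n → ℝ}
    (h : IsBAP c q a) (y : Fin n → ℝ) {m : ℕ} {T w : ℝ} (hT : 0 ≤ T)
    (hw : w = (((2 * m).choose m : ℝ) / 4 ^ m) ^ n)
    (hF : ∀ s ∈ Set.Icc 0 T, ∏ j, Real.cos (Real.pi * (s * a j - y j)) ^ (2 * m) ≤ w / 2) :
    w / 2 * T ≤ (n * m) ^ q / c := by
  set K := Fintype.piFinset (fun _ : Fin n => Finset.range (2 * m + 1)) with hK
  set W : (Fin n → ℕ) → ℝ := fun k => ∏ j, ((2 * m).choose (k j) : ℝ) / 4 ^ m with hW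
  set α : (Fin n → ℕ) → ℝ := fun k => 2 * Real.pi * ∑ j, a j * ((k j : ℝ) - m) with hα
  set β : (Fin n → ℕ) → ℝ := fun k => 2 * Real.pi * ∑ j, -y j * ((k j : ℝ) - m) with hβ
  have hW0 (k) : 0 ≤ W k := Finset.prod_nonneg fun j _ => by positivity
  have hexp (s : ℝ) : ∏ j, Real.cos (Real.pi * (s * a j - y j)) ^ (2 * m) =
      ∑ k ∈ K, W k * Real.cos (α k * s + β k) := by
    rw [prod_cos_pow_eq_sum m (fun j => s * a j - y j)]
    refine Finset.sum_congr rfl fun k _ => ?_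
    have : 2 * Real.pi * ∑ j, (s * a j - y j) * ((k j : ℝ) - m) = α k * s + β k := by
      simp only [hα, hβ]
      rw [mul_assoc (2 * Real.pi), ← mul_add, Finset.sum_mul, ← Finset.sum_add_distrib]
      congr 1
      exact Finset.sum_congr rfl fun j _ => by ring
    rw [this]
  have hupper : ∫ s in (0 : ℝ)..T, ∑ k ∈ K, W k * Real.cos (α k * s + β k) ≤ w / 2 * T := by
    have := intervalIntegral.integral_mono_on (μ := MeasureTheory.volume) (a := 0) (b := T)
      (f := fun s => ∑ k ∈ K, W k * Real.cos (α k * s + β k)) (g := fun _ => w / 2) hT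
      (Continuous.intervalIntegrable (by fun_prop) _ _) (by simp)
      (fun s hs => by rw [← hexp]; exact hF s hs)
    rwa [intervalIntegral.integral_const, sub_zero, smul_eq_mul, mul_comm T] at this
  have hint : ∫ s in (0 : ℝ)..T, ∑ k ∈ K, W k * Real.cos (α k * s + β k) =
      ∑ k ∈ K, W k * ∫ s in (0 : ℝ)..T, Real.cos (α k * s + β k) := by
    rw [intervalIntegral.integral_finsetSum
      (fun k _ => Continuous.intervalIntegrable (by fun_prop) _ _)]
    exact Finset.sum_congr rfl fun k _ => intervalIntegral.integral_const_mul _ _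
  set k₀ : Fin n → ℕ := fun _ => m with hk₀
  have hmem : k₀ ∈ K := by
    rw [hK, Fintype.mem_piFinset]
    intro j
    simp only [hk₀, Finset.mem_range]
    omega
  have hcentral : W k₀ * ∫ s in (0 : ℝ)..T, Real.cos (α k₀ * s + β k₀) = w * T := by
    simp [hW, hα, hβ, hk₀, hw, div_pow]
  have hterm (k) (hk : k ∈ K.erase k₀) :
      |∫ s in (0 : ℝ)..T, Real.cos (α k * s + β k)| ≤ (n * m) ^ q / c := by
    obtain ⟨hne, hkK⟩ := Finset.mem_erase.1 hk
    set ν : Fin n → ℤ := fun j => (k j : ℤ) - m with hν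
    have hν0 : ν ≠ 0 := by
      intro h0
      apply hne
      funext j
      have := congrFun h0 j
      simp only [hν, Pi.zero_apply] at this
      simp only [hk₀]
      omega
    have hνle : ∑ j, |(ν j : ℝ)| ≤ n * m := by
      have : ∀ j ∈ Finset.univ, |(ν j : ℝ)| ≤ m := by
        intro j _
        have hj := Fintype.mem_piFinset.1 hkK j
        rw [Finset.mem_range] at hj
        rw [← Int.cast_abs]
        have : |ν j| ≤ (m : ℤ) := by
          rw [abs_le]
          simp only [hν]
          omega
        exact_mod_cast this
      simpa using Finset.sum_le_sum this
    have hνpos : 0 < ∑ j, |(ν j : ℝ)| := by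
      obtain ⟨j, hj⟩ := Function.ne_iff.1 hν0
      exact Finset.sum_pos' (fun _ _ => abs_nonneg _)
        ⟨j, Finset.mem_univ j, abs_pos.2 (by exact_mod_cast hj)⟩
    have hlow := h.lt_abs hν0
    have hαν : α k = 2 * Real.pi * ∑ j, a j * (ν j : ℝ) := by
      simp [hα, hν]
    have hposlow : 0 < c / (∑ j, |(ν j : ℝ)|) ^ q := by positivity
    have hαpos : 2 * (c / (∑ j, |(ν j : ℝ)|) ^ q) ≤ |α k| := by
      rw [hαν, abs_mul, abs_of_pos (by positivity)]
      have := Real.pi_gt_three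
      gcongr
      linarith
    refine (abs_integral_cos_le (abs_pos.1 (by linarith)) _ _).trans ?_
    calc 2 / |α k| ≤ 2 / (2 * (c / (∑ j, |(ν j : ℝ)|) ^ q)) := by gcongr
      _ = (∑ j, |(ν j : ℝ)|) ^ q / c := by field_simp
      _ ≤ _ := by gcongr
  have hrest : -((n * m) ^ q / c) ≤
      ∑ k ∈ K.erase k₀, W k * ∫ s in (0 : ℝ)..T, Real.cos (α k * s + β k) := by
    have hsum : ∑ k ∈ K.erase k₀, W k ≤ 1 := by
      rw [← sum_prod_choose_div_four_pow n m]
      exact Finset.sum_le_sum_of_subset_of_nonneg (Finset.erase_subset _ _)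
        fun k _ _ => hW0 k
    calc -((n * m : ℝ) ^ q / c) = 1 * -((n * m) ^ q / c) := by ring
      _ ≤ (∑ k ∈ K.erase k₀, W k) * -((n * m) ^ q / c) :=
        mul_le_mul_of_nonpos_right hsum (neg_nonpos.2 (by positivity))
      _ = ∑ k ∈ K.erase k₀, W k * -((n * m) ^ q / c) := Finset.sum_mul _ _ _
      _ ≤ _ := Finset.sum_le_sum fun k hk =>
        mul_le_mul_of_nonneg_left (neg_le_of_abs_le (hterm k hk)) (hW0 k)
  rw [hint, ← Finset.add_sum_erase _ _ hmem, hcentral] at hupper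
  linarith

theorem exists_degree_of_precision {n : ℕ} (hn : 0 < n) :
    ∃ D : ℝ, 0 < D ∧ ∀ ε : ℝ, 0 < ε → ε < 1 → ∃ m : ℕ, 0 < m ∧ (m : ℝ) ^ 2 * ε ^ 5 ≤ D ∧
      Real.exp (-(4 * ε ^ 2)) ^ m ≤ (1 / (2 * m : ℝ)) ^ n / 2 := by
  set B : ℝ := 4 * (5 * n).factorial with hB
  have hfac : (1 : ℝ) ≤ (5 * n).factorial := by
    exact_mod_cast Nat.succ_le_of_lt (Nat.factorial_pos _)
  have hB4 : 4 ≤ B := by linarith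
  refine ⟨(2 * B) ^ 2, by positivity, fun ε hε hε1 => ?_⟩
  set r : ℝ := Real.sqrt (ε ^ 5) with hr
  have hrpos : 0 < r := Real.sqrt_pos.2 (by positivity)
  have hr2 : r ^ 2 = ε ^ 5 := Real.sq_sqrt (by positivity)
  have hr1 : r ≤ 1 := Real.sqrt_le_one.2 (pow_le_one₀ hε.le hε1.le)
  set m := ⌈B / r⌉₊ with hm
  have hm1 : B / r ≤ m := Nat.le_ceil _
  have hm2 : (m : ℝ) < B / r + 1 := Nat.ceil_lt_add_one (by positivity)
  have hmpos : 0 < m := Nat.ceil_pos.2 (by positivity)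
  have hmr : B ≤ m * r := by rwa [div_le_iff₀ hrpos] at hm1
  have hmr2 : m * r ≤ 2 * B := by
    have : (m : ℝ) * r ≤ (B / r + 1) * r := by gcongr
    rw [add_mul, div_mul_cancel₀ _ hrpos.ne'] at this
    linarith
  have hmposR : (0 : ℝ) < m := by exact_mod_cast hmpos
  refine ⟨m, hmpos, ?_, ?_⟩
  · rw [← hr2, ← mul_pow]
    gcongr
  · set u : ℝ := m * (4 * ε ^ 2) with hu
    have hu0 : 0 < u := by positivity
    have hu5 : m * B ^ 4 ≤ u ^ 5 := by
      have h1 : u ^ 5 = 1024 * m * (m * r) ^ 4 := by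
        have : (m * r) ^ 4 = m ^ 4 * (ε ^ 5) ^ 2 := by rw [← hr2]; ring
        rw [this, hu]
        ring
      have h2 : B ^ 4 ≤ (m * r) ^ 4 := by gcongr
      rw [h1]
      have : (m : ℝ) * B ^ 4 ≤ m * (m * r) ^ 4 := by gcongr
      have : 0 ≤ (m : ℝ) * (m * r) ^ 4 := by positivity
      linarith
    have hexp : Real.exp (-(4 * ε ^ 2)) ^ m = (Real.exp u)⁻¹ := by
      rw [← Real.exp_nat_mul, ← Real.exp_neg, hu]
      congr 1
      ring
    have hlow : u ^ (5 * n) / (5 * n).factorial ≤ Real.exp u :=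
      Real.pow_div_factorial_le_exp u hu0.le _
    have hpow : (m * B ^ 4) ^ n ≤ u ^ (5 * n) := by
      rw [pow_mul]
      gcongr
    have hBn : 2 * (2 : ℝ) ^ n * (5 * n).factorial ≤ (B ^ 4) ^ n := by
      have h1 : B ≤ B ^ n := le_self_pow₀ (by linarith) hn.ne'
      have h2 : (2 : ℝ) ^ n ≤ B ^ n := by gcongr; linarith
      have h3 : (1 : ℝ) ≤ B ^ n := by linarith
      calc 2 * (2 : ℝ) ^ n * (5 * n).factorial ≤ 2 ^ n * B := by
            rw [hB]
            have : (0 : ℝ) < 2 ^ n := by positivity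
            nlinarith
        _ ≤ B ^ n * B ^ n := by gcongr
        _ ≤ (B ^ n * B ^ n) * (B ^ n * B ^ n) :=
          le_mul_of_one_le_right (by positivity) (one_le_mul_of_one_le_of_one_le h3 h3)
        _ = _ := by
          rw [← mul_pow, ← mul_pow]
          congr 1
          ring
    have hmain : 2 * (2 * m : ℝ) ^ n ≤ Real.exp u := by
      refine le_trans ?_ hlow
      rw [le_div_iff₀ (by positivity)]
      refine le_trans ?_ hpow
      calc 2 * (2 * m : ℝ) ^ n * (5 * n).factorial
          = m ^ n * (2 * 2 ^ n * (5 * n).factorial) := by rw [mul_pow]; ring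
        _ ≤ m ^ n * (B ^ 4) ^ n := by gcongr
        _ = _ := (mul_pow _ _ _).symm
    rw [hexp]
    calc (Real.exp u)⁻¹ ≤ (2 * (2 * m : ℝ) ^ n)⁻¹ := by gcongr
      _ = _ := by rw [one_div, inv_pow, mul_inv]; ring

/-- Effective Kronecker theorem for a badly approximable direction. -/
theorem IsBAP.exists_linear_flow_near {n : ℕ} (hn : 0 < n) {c : ℝ} (hc : 0 < c) {q : ℕ}
    {a : Fin n → ℝ} (h : IsBAP c q a) :
    ∃ C : ℝ, 0 < C ∧ ∀ ε : ℝ, 0 < ε → ε < 1 → ∀ y : Fin n → ℝ, ∃ s : ℝ, 0 ≤ s ∧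
      s ^ 2 * ε ^ (5 * (q + n)) ≤ C ∧
      ∀ j, |s * a j - y j - round (s * a j - y j)| ≤ ε := by
  obtain ⟨D, hD, hdeg⟩ := exists_degree_of_precision hn
  set G : ℝ := 3 * n ^ q * 2 ^ n / c with hG
  have hGpos : 0 < G := by positivity
  refine ⟨G ^ 2 * D ^ (q + n), by positivity, fun ε hε hε1 y => ?_⟩
  obtain ⟨m, hm, hmD, hmexp⟩ := hdeg ε hε hε1
  have hmR : (0 : ℝ) < m := by exact_mod_cast hm
  set T : ℝ := G * m ^ (q + n) with hT
  have hTpos : 0 < T := by positivity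
  set w : ℝ := (((2 * m).choose m : ℝ) / 4 ^ m) ^ n with hw
  have hwlow : (1 / (2 * m : ℝ)) ^ n ≤ w := by
    have hcb := Nat.four_pow_le_two_mul_self_mul_centralBinom m hm
    rw [Nat.centralBinom_eq_two_mul_choose] at hcb
    have hcb' : (4 : ℝ) ^ m ≤ 2 * m * (2 * m).choose m := by exact_mod_cast hcb
    rw [hw]
    gcongr ?_ ^ n
    rw [div_le_div_iff₀ (by positivity) (by positivity)]
    linarith
  by_contra! hcon
  have hF : ∀ s ∈ Set.Icc 0 T,
      ∏ j, Real.cos (Real.pi * (s * a j - y j)) ^ (2 * m) ≤ w / 2 := by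
    intro s hs
    have hsT : s ^ 2 * ε ^ (5 * (q + n)) ≤ G ^ 2 * D ^ (q + n) := by
      have hs0 := hs.1
      calc s ^ 2 * ε ^ (5 * (q + n)) ≤ T ^ 2 * ε ^ (5 * (q + n)) := by gcongr; exact hs.2
        _ = G ^ 2 * (m ^ 2 * ε ^ 5) ^ (q + n) := by
          rw [hT, mul_pow, mul_pow, ← pow_mul, ← pow_mul, ← pow_mul, mul_comm (q + n) 2, mul_assoc]
        _ ≤ _ := by gcongr
    obtain ⟨i, hi⟩ := hcon s hs.1 hsT
    rw [← Finset.mul_prod_erase _ _ (Finset.mem_univ i)]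
    have hothers : ∏ j ∈ Finset.univ.erase i,
        Real.cos (Real.pi * (s * a j - y j)) ^ (2 * m) ≤ 1 := by
      refine Finset.prod_le_one (fun j _ => ?_) fun j _ => ?_ <;> rw [pow_mul]
      · positivity
      · exact pow_le_one₀ (sq_nonneg _) (Real.cos_sq_le_one _)
    calc _ ≤ Real.cos (Real.pi * (s * a i - y i)) ^ (2 * m) * 1 := by
          gcongr
          rw [pow_mul]
          positivity
      _ ≤ Real.exp (-(4 * ε ^ 2)) ^ m := by
          rw [mul_one, pow_mul]
          gcongr
          exact cos_sq_le_of_lt_abs_sub_round hε hi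
      _ ≤ (1 / (2 * m : ℝ)) ^ n / 2 := hmexp
      _ ≤ w / 2 := by gcongr
  have htime := h.time_le hc y hTpos.le hw hF
  have hlow : (1 / (2 * m : ℝ)) ^ n / 2 * T ≤ w / 2 * T := by gcongr
  have heq : (1 / (2 * m : ℝ)) ^ n / 2 * T = 3 / 2 * ((n * m) ^ q / c) := by
    rw [hT, hG, div_pow, one_pow, mul_pow, mul_pow, pow_add]
    field_simp
  have : 0 < ((n : ℝ) * m) ^ q / c := by positivity
  linarith

/-- In dimension one a badly approximable linear flow covers the circle in bounded time. -/
theorem IsBAP.exists_linear_flow_eq {c : ℝ} (hc : 0 < c) {q : ℕ}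
    {a : Fin 1 → ℝ} (h : IsBAP c q a) :
    ∃ C : ℝ, 0 < C ∧ ∀ y : Fin 1 → ℝ, ∃ s : ℝ, 0 ≤ s ∧ s ^ 2 ≤ C ∧
      ∀ j, s * a j - y j - round (s * a j - y j) = 0 := by
  have ha : 0 < |a 0| := by
    have := h.lt_abs (ν := fun _ => 1) (by simp [funext_iff])
    simp at this
    exact hc.trans this
  have ha0 : a 0 ≠ 0 := abs_pos.1 ha
  refine ⟨(1 / |a 0|) ^ 2, by positivity, fun y => ?_⟩
  obtain ⟨s, hs0, hs1, k, hk⟩ : ∃ s : ℝ, 0 ≤ s ∧ s ≤ 1 / |a 0| ∧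
      ∃ k : ℤ, s * a 0 - y 0 = k := by
    refine ⟨Int.fract (y 0 / a 0 * |a 0|) / |a 0|, by positivity, by
      gcongr; exact (Int.fract_lt_one _).le, ?_⟩
    rcases abs_cases (a 0) with ⟨he, -⟩ | ⟨he, -⟩
    · refine ⟨-⌊y 0⌋, ?_⟩
      rw [he, div_mul_cancel₀ _ ha0, div_mul_cancel₀ _ ha0, Int.fract]
      push_cast
      ring
    · refine ⟨⌊-y 0⌋, ?_⟩
      rw [he, mul_neg, div_mul_cancel₀ _ ha0, div_neg, neg_mul, div_mul_cancel₀ _ ha0, Int.fract]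
      ring
  refine ⟨s, hs0, by gcongr, fun j => ?_⟩
  rw [Subsingleton.elim j 0, hk]
  simp

theorem IsBAP.exists_linear_flow_near' {n : ℕ} (hn : 0 < n) {c : ℝ} (hc : 0 < c) {q : ℕ}
    {a : Fin n → ℝ} (h : IsBAP c q a) :
    ∃ C : ℝ, 0 < C ∧ ∀ ε : ℝ, 0 < ε → ε < 1 → ∀ y : Fin n → ℝ, ∃ s : ℝ, 0 ≤ s ∧
      s ^ 2 * ε ^ ((q + 1) * n * (n + 1) + q * ∑ i ∈ Finset.range (n - 1),
          (i + 1) * (2 * n - i)) ≤ C ∧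
      ∀ j, |s * a j - y j - round (s * a j - y j)| ≤ ε := by
  rcases (Nat.succ_le_of_lt hn).eq_or_lt with rfl | hn2
  · obtain ⟨C, hC, hflow⟩ := h.exists_linear_flow_eq hc
    refine ⟨C, hC, fun ε hε hε1 y => ?_⟩
    obtain ⟨s, hs, hsC, hj⟩ := hflow y
    refine ⟨s, hs, ?_, fun j => by rw [hj, abs_zero]; exact hε.le⟩
    exact (mul_le_of_le_one_right (sq_nonneg s) (pow_le_one₀ hε.le hε1.le)).trans hsC
  · have hq := h.exponent_pos hc hn
    have hE : 5 * (q + n) ≤ (q + 1) * n * (n + 1) + q * ∑ i ∈ Finset.range (n - 1),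
        (i + 1) * (2 * n - i) := by
      have hsum : 2 * n ≤ ∑ i ∈ Finset.range (n - 1), (i + 1) * (2 * n - i) := by
        have := Finset.single_le_sum (f := fun i => (i + 1) * (2 * n - i))
          (fun i _ => Nat.zero_le _) (Finset.mem_range.2 (by omega : 0 < n - 1))
        simpa using this
      have hmul := Nat.mul_le_mul_left q hsum
      obtain ⟨k, rfl⟩ : ∃ k, n = k + 2 := ⟨n - 2, by omega⟩
      obtain ⟨l, rfl⟩ : ∃ l, q = l + 1 := ⟨q - 1, by omega⟩
      refine le_trans ?_ (Nat.add_le_add_left hmul _)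
      ring_nf
      nlinarith [Nat.zero_le (k * l), Nat.zero_le (k ^ 2 * l), Nat.zero_le (k ^ 2)]
    obtain ⟨C, hC, hflow⟩ := h.exists_linear_flow_near hn hc
    refine ⟨C, hC, fun ε hε hε1 y => ?_⟩
    obtain ⟨s, hs, hsC, hj⟩ := hflow ε hε hε1 y
    refine ⟨s, hs, le_trans ?_ hsC, hj⟩
    gcongr ?_ * ?_
    exact pow_le_pow_of_le_one hε.le hε1.le hE

theorem abs_dilated_polynomial_sub_linear_le {d : ℕ} (hd : 0 < d) (b : Fin d → ℝ) {t lam : ℝ}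
    (ht : t ∈ Set.Icc (0 : ℝ) 1) (hlam : 0 ≤ lam) :
    |lam * ∑ k : Fin d, b k * t ^ ((k : ℕ) + 1) - lam * t * b ⟨0, hd⟩| ≤
      lam * t ^ 2 * ∑ k, |b k| := by
  rw [← Finset.add_sum_erase _ _ (Finset.mem_univ (⟨0, hd⟩ : Fin d))]
  have : lam * (b ⟨0, hd⟩ * t ^ (((⟨0, hd⟩ : Fin d) : ℕ) + 1) +
      ∑ k ∈ Finset.univ.erase ⟨0, hd⟩, b k * t ^ ((k : ℕ) + 1)) - lam * t * b ⟨0, hd⟩ =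
      lam * ∑ k ∈ Finset.univ.erase ⟨0, hd⟩, b k * t ^ ((k : ℕ) + 1) := by
    simp only [zero_add, pow_one]
    ring
  rw [this, abs_mul, abs_of_nonneg hlam, mul_assoc]
  gcongr
  calc |∑ k ∈ Finset.univ.erase ⟨0, hd⟩, b k * t ^ ((k : ℕ) + 1)|
      ≤ ∑ k ∈ Finset.univ.erase ⟨0, hd⟩, |b k * t ^ ((k : ℕ) + 1)| :=
        Finset.abs_sum_le_sum_abs _ _
    _ ≤ ∑ k ∈ Finset.univ.erase ⟨0, hd⟩, t ^ 2 * |b k| := by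
        refine Finset.sum_le_sum fun k hk => ?_
        have hk0 : (k : ℕ) ≠ 0 := fun h0 => (Finset.mem_erase.1 hk).1 (Fin.ext h0)
        have hpow : t ^ ((k : ℕ) + 1) ≤ t ^ 2 := pow_le_pow_of_le_one ht.1 ht.2 (by omega)
        rw [abs_mul, abs_of_nonneg (pow_nonneg ht.1 _), mul_comm]
        gcongr
    _ ≤ ∑ k, t ^ 2 * |b k| :=
        Finset.sum_le_sum_of_subset_of_nonneg (Finset.erase_subset _ _)
          fun k _ _ => by positivity
    _ = _ := (Finset.mul_sum _ _ _).symm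

/-- Let `p : ℝ → ℝ^n` be the polynomial curve `p_j(t) = ∑_{k=1}^d a_{jk} t^k` and assume the
vector `(a_{11}, …, a_{n1})` of linear coefficients is `(c,q)`-badly approximable by
rationals. Then there is `C > 0` (depending on `p, n, c, q`) such that for every `ε > 0` and
every `λ ≥ A(ε) = C ε^{-(2((q+1)n(n+1)/2 + q ∑_{i=0}^{n-2} (i+1)(2n-i)/2) + 1)}`, the
projection of `λ p([0,1])` to `𝕋^n = ℝ^n/ℤ^n` is `ε`-dense. -/
theorem dilated_polynomial_curve_eps_dense (n d : ℕ) (hd : 0 < d)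
    (A : Matrix (Fin n) (Fin d) ℝ) (c : ℝ) (hc : 0 < c) (q : ℕ)
    (hbap : IsBAP c q (fun j => A j ⟨0, hd⟩)) :
    ∃ C > 0, ∀ ε : ℝ, 0 < ε → ∀ lam : ℝ,
      C * ε ^ (-(((q + 1) * n * (n + 1) + q * ∑ i ∈ Finset.range (n - 1),
          (i + 1) * (2 * n - i) + 1 : ℕ) : ℝ)) ≤ lam →
      ∀ z : Fin n → AddCircle (1 : ℝ), ∃ t ∈ Set.Icc (0:ℝ) 1,
        dist (fun j => ((lam * ∑ k : Fin d, A j k * t ^ ((k : ℕ) + 1) : ℝ) :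
          AddCircle (1 : ℝ))) z ≤ ε := by
  set E : ℕ := (q + 1) * n * (n + 1) + q * ∑ i ∈ Finset.range (n - 1),
    (i + 1) * (2 * n - i) with hE
  rcases n.eq_zero_or_pos with rfl | hn
  · refine ⟨1, one_pos, fun ε hε lam _ z => ⟨0, by simp, ?_⟩⟩
    rw [dist_pi_le_iff hε.le]
    exact fun j => j.elim0
  obtain ⟨C₁, hC₁, hflow⟩ := hbap.exists_linear_flow_near' hn hc
  set K : ℝ := ∑ j, ∑ k, |A j k| with hK
  have hK0 : 0 ≤ K := by positivity
  have hKj (j) : ∑ k, |A j k| ≤ K :=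
    Finset.single_le_sum (f := fun j => ∑ k, |A j k|) (fun j _ => by positivity)
      (Finset.mem_univ j)
  set C : ℝ := 1 + C₁ * 2 ^ E * (2 * K + 1) with hCdef
  have hC1 : 1 ≤ C := by
    rw [hCdef]
    have : 0 ≤ C₁ * 2 ^ E * (2 * K + 1) := by positivity
    linarith
  refine ⟨C, by positivity, fun ε hε lam hlam z => ?_⟩
  rcases le_or_gt (1 / 2) ε with hhalf | hhalf
  · refine ⟨0, by simp, ?_⟩
    rw [dist_pi_le_iff hε.le]
    intro j
    rw [dist_eq_norm]
    refine (AddCircle.norm_le_half_period (p := (1 : ℝ)) one_ne_zero).trans ?_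
    simpa using hhalf
  have hε1 : ε < 1 := by linarith
  rw [Real.rpow_neg hε.le, Real.rpow_natCast, ← div_eq_mul_inv, div_le_iff₀ (by positivity),
    pow_succ] at hlam
  have hpowpos : 0 < ε ^ E := by positivity
  have hpow1 : ε ^ E ≤ 1 := pow_le_one₀ hε.le hε1.le
  have hlampos : 0 < lam := by
    by_contra! hneg
    have : lam * (ε ^ E * ε) ≤ 0 := mul_nonpos_of_nonpos_of_nonneg hneg (by positivity)
    linarith
  choose y hy using fun j => QuotientAddGroup.mk_surjective (z j)
  obtain ⟨s, hs, hsC, hsy⟩ := hflow (ε / 2) (by positivity) (by linarith) y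
  have hs2 : s ^ 2 * ε ^ E ≤ C₁ * 2 ^ E := by
    rw [div_pow, ← mul_div_assoc, div_le_iff₀ (by positivity)] at hsC
    exact hsC
  have hs2K : s ^ 2 * (2 * K + 1) ≤ lam * ε := by
    refine le_of_mul_le_mul_right ?_ hpowpos
    calc s ^ 2 * (2 * K + 1) * ε ^ E = s ^ 2 * ε ^ E * (2 * K + 1) := by ring
      _ ≤ C₁ * 2 ^ E * (2 * K + 1) := by gcongr
      _ ≤ C := by rw [hCdef]; linarith
      _ ≤ _ := by linarith
  have hlam1 : 1 ≤ lam := by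
    have : lam * (ε ^ E * ε) ≤ lam * 1 := by
      gcongr
      exact mul_le_one₀ hpow1 hε.le hε1.le
    linarith
  have hslam : s ≤ lam := by
    refine le_of_sq_le_sq ?_ hlampos.le
    nlinarith [sq_nonneg s, mul_nonneg (sq_nonneg s) hK0]
  have ht : s / lam ∈ Set.Icc (0 : ℝ) 1 := ⟨by positivity, (div_le_one hlampos).2 hslam⟩
  refine ⟨s / lam, ht, ?_⟩
  rw [dist_pi_le_iff hε.le]
  intro j
  have hrem := abs_dilated_polynomial_sub_linear_le hd (A j) ht hlampos.le
  rw [mul_div_cancel₀ _ hlampos.ne'] at hrem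
  have hrem' : lam * (s / lam) ^ 2 * ∑ k, |A j k| ≤ ε / 2 := by
    calc lam * (s / lam) ^ 2 * ∑ k, |A j k| ≤ lam * (s / lam) ^ 2 * K := by
          gcongr
          exact hKj j
      _ = s ^ 2 * K / lam := by field_simp
      _ ≤ ε / 2 := by
          rw [div_le_iff₀ hlampos]
          nlinarith [sq_nonneg s]
  set P : ℝ := lam * ∑ k : Fin d, A j k * (s / lam) ^ ((k : ℕ) + 1) with hP
  rw [dist_eq_norm, ← hy j]
  change ‖((P - y j : ℝ) : UnitAddCircle)‖ ≤ ε
  rw [UnitAddCircle.norm_eq]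
  refine (round_le _ (round (s * A j ⟨0, hd⟩ - y j))).trans ?_
  have hsplit : P - y j - round (s * A j ⟨0, hd⟩ - y j) = (P - s * A j ⟨0, hd⟩) +
      (s * A j ⟨0, hd⟩ - y j - round (s * A j ⟨0, hd⟩ - y j)) := by ring
  rw [hsplit]
  refine (abs_add_le _ _).trans ?_
  linarith [hsy j]
end

section
/- Let a ∈ ℝ be (c,q)-badly approximable by rationals, i.e., ‖a ν‖_𝕋 > c/|ν|^q for every nonzero integer ν. Then for every ε > 0, T_a(ε) ≤ 1/(c ε^{q+1}); that is, the points a, 2a, …, Na taken mod 1 form an ε-dense subset of the circle 𝕋 = ℝ/ℤ whenever N ≥ 1/(c ε^{q+1}). -/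
theorem exists_nat_mul_sub_sub_int_le_of_pos {d : ℝ} (hd : 0 < d) (hd1 : d ≤ 1) (z : ℝ) :
    ∃ j : ℕ, 1 ≤ j ∧ (j : ℝ) * d ≤ 1 ∧ ∃ n : ℤ, |(j : ℝ) * d - z - n| ≤ d := by
  have hw0 := Int.fract_nonneg z
  have hw1 := (Int.fract_lt_one z).le
  have hz := Int.fract_add_floor z
  rcases lt_or_ge (Int.fract z) d with h | h
  · refine ⟨1, le_rfl, by simpa using hd1, -⌊z⌋, ?_⟩
    rw [abs_le]
    push_cast
    constructor <;> linarith
  · have hj := Nat.floor_le (div_nonneg hw0 hd.le)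
    rw [le_div_iff₀ hd] at hj
    have hj' := Nat.lt_floor_add_one (Int.fract z / d)
    rw [div_lt_iff₀ hd] at hj'
    refine ⟨⌊Int.fract z / d⌋₊, Nat.le_floor ?_, hj.trans hw1, -⌊z⌋, ?_⟩
    · simpa using (one_le_div hd).2 h
    · rw [abs_le]
      push_cast
      constructor <;> linarith

theorem exists_nat_mul_sub_sub_int_le {d : ℝ} (hd : d ≠ 0) (hd1 : |d| ≤ 1) (z : ℝ) :
    ∃ j : ℕ, 1 ≤ j ∧ (j : ℝ) * |d| ≤ 1 ∧ ∃ n : ℤ, |(j : ℝ) * d - z - n| ≤ |d| := by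
  rcases hd.lt_or_gt with h | h
  · rw [abs_of_neg h] at hd1 ⊢
    obtain ⟨j, hj, hjd, n, hn⟩ :=
      exists_nat_mul_sub_sub_int_le_of_pos (neg_pos.2 h) hd1 (-z)
    refine ⟨j, hj, hjd, -n, ?_⟩
    rw [← abs_neg]
    convert hn using 2
    push_cast
    ring
  · rw [abs_of_pos h] at hd1 ⊢
    exact exists_nat_mul_sub_sub_int_le_of_pos h hd1 z

/-- Let `a ∈ ℝ` be `(c,q)`-badly approximable by rationals, i.e. `‖aν‖_𝕋 > c/|ν|^q` for every
nonzero integer `ν`, where `‖z‖_𝕋 = inf_{m∈ℤ}|z−m|`. Then for every `ε > 0` the points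
`a, 2a, …, Na` taken mod `1` form an `ε`-dense subset of the circle `𝕋 = ℝ/ℤ` whenever
`N ≥ 1/(c ε^{q+1})`; that is, `T_a(ε) ≤ 1/(c ε^{q+1})`. -/
theorem circle_orbit_eps_dense (c : ℝ) (hc : 0 < c) (q : ℕ) (a : ℝ)
    (ha : ∀ ν : ℤ, ν ≠ 0 → c / |(ν : ℝ)| ^ q < |a * (ν : ℝ) - round (a * (ν : ℝ))|)
    (ε : ℝ) (hε : 0 < ε) (N : ℕ) (hN : 1 / (c * ε ^ (q + 1)) ≤ (N : ℝ)) :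
    ∀ z : ℝ, ∃ k ∈ Finset.Icc 1 N,
      |(k : ℝ) * a - z - round ((k : ℝ) * a - z)| ≤ ε := by
  intro z
  have hN0 : 0 < N := by
    have : (0 : ℝ) < N := lt_of_lt_of_le (by positivity) hN
    exact_mod_cast this
  rcases le_or_gt 1 ε with hε1 | hε1
  · refine ⟨1, Finset.mem_Icc.2 ⟨le_rfl, hN0⟩, (abs_sub_round _).trans ?_⟩
    linarith
  have hn : 0 < ⌊1 / ε⌋₊ := Nat.floor_pos.2 ((one_le_div hε).2 hε1.le)
  obtain ⟨k, hk0, hkn, hk⟩ := Real.exists_nat_abs_mul_sub_round_le a hn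
  have hkε : (k : ℝ) * ε ≤ 1 := by
    rw [← le_div_iff₀ hε]
    exact (Nat.le_floor_iff (by positivity)).1 hkn
  have hk0' : (0 : ℝ) < k := by exact_mod_cast hk0
  set d := (k : ℝ) * a - round ((k : ℝ) * a) with hd
  have hdε : |d| ≤ ε := hk.trans (by
    rw [div_le_comm₀ (by positivity) hε]
    exact (Nat.lt_floor_add_one _).le)
  have hcd : c / (k : ℝ) ^ q < |d| := by
    have h := ha k (by exact_mod_cast hk0.ne')
    rwa [Int.cast_natCast, abs_of_pos hk0', mul_comm a, ← hd] at h
  have hd0 : 0 < |d| := lt_of_le_of_lt (by positivity) hcd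
  have hcεd : c * ε ^ q ≤ |d| := by
    refine le_trans ?_ hcd.le
    rw [le_div_iff₀ (by positivity), mul_assoc, ← mul_pow, mul_comm ε]
    exact mul_le_of_le_one_right hc.le (pow_le_one₀ (by positivity) hkε)
  obtain ⟨j, hj, hjd, n, hjn⟩ :=
    exists_nat_mul_sub_sub_int_le (abs_pos.1 hd0) (hdε.trans hε1.le) z
  refine ⟨j * k, Finset.mem_Icc.2 ⟨Nat.mul_pos hj hk0, ?_⟩, ?_⟩
  · have hjk : ((j * k : ℕ) : ℝ) ≤ N := by
      refine le_trans ?_ hN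
      rw [le_div_iff₀ (by positivity)]
      push_cast
      calc (j : ℝ) * k * (c * ε ^ (q + 1)) = (j * (c * ε ^ q)) * (k * ε) := by ring
        _ ≤ (j * |d|) * (k * ε) := by gcongr
        _ ≤ 1 := mul_le_one₀ hjd (by positivity) hkε
    exact_mod_cast hjk
  · refine (round_le _ (j * round ((k : ℝ) * a) + n)).trans (le_trans (le_of_eq ?_)
      (hjn.trans hdε))
    rw [hd]
    push_cast
    congr 1
    ring
end

section
/- For every n ≥ 1 and q ∈ ℕ there exists a constant C > 0, depending only on n and q, such that for every c' > 0, every ε > 0, and every vector a ∈ ℝ^n that is (c',q)-badly approximable by rationals, one has T_a(ε) ≤ C (1/c')^n ε^{-((q+1)n(n+1)/2 + q ∑_{i=0}^{n-2} (i+1)(2n-i)/2)}, where for n = 1 the sum ∑_{i=0}^{n-2}(i+1)(2n-i)/2 is defined to be 0. -/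
open Finset

/-- The additive character `t ↦ exp (2πit)` of `ℝ`, trivial on `ℤ`. -/
noncomputable def unitExp (t : ℝ) : ℂ := Complex.exp (Complex.I * ((2 * Real.pi * t : ℝ) : ℂ))

lemma unitExp_add (s t : ℝ) : unitExp (s + t) = unitExp s * unitExp t := by
  unfold unitExp
  rw [← Complex.exp_add]
  push_cast
  ring_nf

@[simp] lemma unitExp_zero : unitExp 0 = 1 := by simp [unitExp]

@[simp] lemma norm_unitExp (t : ℝ) : ‖unitExp t‖ = 1 := by
  rw [unitExp, mul_comm, Complex.norm_exp_ofReal_mul_I]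

lemma unitExp_nat_mul (k : ℕ) (t : ℝ) : unitExp (k * t) = unitExp t ^ k := by
  unfold unitExp
  rw [← Complex.exp_nat_mul]
  push_cast
  ring_nf

lemma unitExp_sum {ι : Type*} (s : Finset ι) (f : ι → ℝ) :
    unitExp (∑ i ∈ s, f i) = ∏ i ∈ s, unitExp (f i) := by
  classical
  induction s using Finset.induction_on with
  | empty => simp
  | insert i s hi ih => rw [sum_insert hi, prod_insert hi, unitExp_add, ih]

lemma conj_unitExp (t : ℝ) : (starRingEnd ℂ) (unitExp t) = unitExp (-t) := by
  unfold unitExp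
  rw [← Complex.exp_conj, map_mul, Complex.conj_I, Complex.conj_ofReal]
  push_cast
  ring_nf

lemma unitExp_int (m : ℤ) : unitExp m = 1 := by
  unfold unitExp
  rw [Complex.exp_eq_one_iff]
  exact ⟨m, by push_cast; ring⟩

lemma four_mul_abs_sub_round_le (t : ℝ) : 4 * |t - round t| ≤ ‖unitExp t - 1‖ := by
  have h1 : unitExp t = unitExp (t - round t) := by
    conv_lhs => rw [← sub_add_cancel t (round t : ℝ), unitExp_add, unitExp_int, mul_one]
  rw [h1]
  have hr := abs_sub_round t
  set r := t - round t
  rw [unitExp, Complex.norm_exp_I_mul_ofReal_sub_one, norm_mul, Real.norm_two, Real.norm_eq_abs]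
  have h2 : 2 * Real.pi * r / 2 = Real.pi * r := by ring
  have h3 := Real.mul_abs_le_abs_sin (x := Real.pi * r) (by
    rw [abs_mul, abs_of_pos Real.pi_pos]
    nlinarith [Real.pi_pos])
  rw [abs_mul, abs_of_pos Real.pi_pos] at h3
  have h4 : 2 / Real.pi * (Real.pi * |r|) = 2 * |r| := by
    field_simp
  rw [h2]
  linarith

lemma norm_geom_sum_Icc_mul_le {z : ℂ} (hz : ‖z‖ = 1) (N : ℕ) :
    ‖∑ k ∈ Icc 1 N, z ^ k‖ * ‖z - 1‖ ≤ 2 := by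
  have h : (∑ k ∈ Icc 1 N, z ^ k) * (z - 1) = z ^ (N + 1) - z := by
    induction N with
    | zero => simp
    | succ N ih =>
      rw [sum_Icc_succ_top (by omega), add_mul, ih]
      ring
  rw [← norm_mul, h]
  refine (norm_sub_le _ _).trans ?_
  rw [norm_pow, hz]
  norm_num

/-- Quasi-orthogonality of finitely many unimodular geometric progressions whose pairwise
correlations are bounded by `B`. -/
lemma abs_sum_normSq_sub_le {ι : Type*} [DecidableEq ι] (H : Finset ι) (b ζ : ι → ℂ) (N : ℕ)
    {B : ℝ} (hB : 0 ≤ B) (hζ : ∀ h, ‖ζ h‖ = 1)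
    (hcorr : ∀ h ∈ H, ∀ h' ∈ H, h ≠ h' →
      ‖∑ k ∈ Icc 1 N, (ζ h * (starRingEnd ℂ) (ζ h')) ^ k‖ ≤ B) :
    |∑ k ∈ Icc 1 N, ‖∑ h ∈ H, b h * ζ h ^ k‖ ^ 2 - N * ∑ h ∈ H, ‖b h‖ ^ 2| ≤
      B * (#H * ∑ h ∈ H, ‖b h‖ ^ 2) := by
  have key : ((∑ k ∈ Icc 1 N, ‖∑ h ∈ H, b h * ζ h ^ k‖ ^ 2 - N * ∑ h ∈ H, ‖b h‖ ^ 2 : ℝ) : ℂ)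
      = ∑ h ∈ H, ∑ h' ∈ H, b h * (starRingEnd ℂ) (b h') *
        (if h = h' then 0 else ∑ k ∈ Icc 1 N, (ζ h * (starRingEnd ℂ) (ζ h')) ^ k) := by
    have hdiag : (N : ℂ) * ∑ h ∈ H, (‖b h‖ : ℂ) ^ 2 =
        ∑ h ∈ H, ∑ h' ∈ H, b h * (starRingEnd ℂ) (b h') *
          (if h = h' then ∑ k ∈ Icc 1 N, (ζ h * (starRingEnd ℂ) (ζ h')) ^ k else 0) := by
      rw [mul_sum]
      refine sum_congr rfl fun h hh => ?_
      simp only [mul_ite, mul_zero, sum_ite_eq, hh, if_true]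
      rw [Complex.mul_conj', Complex.mul_conj', hζ]
      simp [mul_comm]
    have hfull : ∑ k ∈ Icc 1 N, (‖∑ h ∈ H, b h * ζ h ^ k‖ : ℂ) ^ 2 =
        ∑ h ∈ H, ∑ h' ∈ H, b h * (starRingEnd ℂ) (b h') *
          ∑ k ∈ Icc 1 N, (ζ h * (starRingEnd ℂ) (ζ h')) ^ k := by
      simp_rw [← Complex.mul_conj', map_sum, sum_mul_sum, mul_sum]
      rw [sum_comm]
      refine sum_congr rfl fun h _ => ?_
      rw [sum_comm]
      refine sum_congr rfl fun h' _ => sum_congr rfl fun k _ => ?_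
      simp only [map_mul, map_pow]
      ring
    push_cast
    rw [hfull, hdiag, ← sum_sub_distrib]
    refine sum_congr rfl fun h _ => ?_
    rw [← sum_sub_distrib]
    refine sum_congr rfl fun h' _ => ?_
    split_ifs <;> ring
  rw [← Real.norm_eq_abs, ← Complex.norm_real, key]
  calc _ ≤ ∑ h ∈ H, ∑ h' ∈ H, ‖b h‖ * ‖b h'‖ * B := by
        refine norm_sum_le_of_le _ fun h hh => norm_sum_le_of_le _ fun h' hh' => ?_
        rw [norm_mul, norm_mul, RCLike.norm_conj]
        refine mul_le_mul_of_nonneg_left ?_ (by positivity)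
        split_ifs with heq
        · simpa using hB
        · exact hcorr h hh h' hh' heq
    _ = B * (∑ h ∈ H, ‖b h‖) ^ 2 := by
        rw [sq, sum_mul_sum, mul_sum]
        refine sum_congr rfl fun h _ => ?_
        rw [mul_sum]
        exact sum_congr rfl fun h' _ => by ring
    _ ≤ _ := mul_le_mul_of_nonneg_left sq_sum_le_card_mul_sum_sq hB

lemma IsBAP.norm_geom_sum_le {n : ℕ} {c : ℝ} (hc : 0 < c) {q : ℕ} {a : Fin n → ℝ}
    (ha : IsBAP c q a) {ν : Fin n → ℤ} (hν : ν ≠ 0) {R : ℝ} (hR : ∑ i, |(ν i : ℝ)| ≤ R) (N : ℕ) :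
    ‖∑ k ∈ Icc 1 N, unitExp (∑ i, a i * (ν i : ℝ)) ^ k‖ ≤ R ^ q / (2 * c) := by
  have hpos : 0 < ∑ i, |(ν i : ℝ)| := by
    obtain ⟨i, hi⟩ := Function.ne_iff.mp hν
    refine sum_pos' (fun _ _ => abs_nonneg _) ⟨i, mem_univ _, ?_⟩
    have : (ν i : ℝ) ≠ 0 := by exact_mod_cast hi
    positivity
  have hRpos : 0 < R := hpos.trans_le hR
  have h1 : c / R ^ q ≤ c / (∑ i, |(ν i : ℝ)|) ^ q := by gcongr
  have h2 := four_mul_abs_sub_round_le (∑ i, a i * (ν i : ℝ))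
  have h3 := norm_geom_sum_Icc_mul_le (norm_unitExp (∑ i, a i * (ν i : ℝ))) N
  have h4 : 4 * (c / R ^ q) ≤ ‖unitExp (∑ i, a i * (ν i : ℝ)) - 1‖ := by
    linarith [ha ν hν]
  have h5 := (mul_le_mul_of_nonneg_left h4 (norm_nonneg
    (∑ k ∈ Icc 1 N, unitExp (∑ i, a i * (ν i : ℝ)) ^ k))).trans h3
  rw [le_div_iff₀ (by positivity)]
  have h6 : 0 < R ^ q := by positivity
  have h7 : ‖∑ k ∈ Icc 1 N, unitExp (∑ i, a i * (ν i : ℝ)) ^ k‖ * (4 * (c / R ^ q)) =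
      ‖∑ k ∈ Icc 1 N, unitExp (∑ i, a i * (ν i : ℝ)) ^ k‖ * (4 * c) / R ^ q := by ring
  rw [h7, div_le_iff₀ h6] at h5
  linarith

/-- Mean square along the orbit of a product of trigonometric polynomials with frequencies
in `{0, …, L - 1}`. -/
lemma IsBAP.abs_sum_prod_normSq_sub_le {n : ℕ} {c : ℝ} (hc : 0 < c) {q : ℕ} {a : Fin n → ℝ}
    (ha : IsBAP c q a) (y : Fin n → ℝ) (L N : ℕ) (v : Fin n → ℕ → ℝ) :
    |∑ k ∈ Icc 1 N, ∏ l, ‖∑ j ∈ range L, (v l j : ℂ) * unitExp (j * (k * a l - y l))‖ ^ 2 -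
        N * ∏ l, ∑ j ∈ range L, v l j ^ 2| ≤
      (n * L : ℝ) ^ q / (2 * c) * ((L : ℝ) ^ n * ∏ l, ∑ j ∈ range L, v l j ^ 2) := by
  let H : Finset (Fin n → ℕ) := Fintype.piFinset fun _ => range L
  let b : (Fin n → ℕ) → ℂ := fun h => ∏ l, ((v l (h l) : ℂ) * unitExp (-(h l * y l)))
  let ζ : (Fin n → ℕ) → ℂ := fun h => unitExp (∑ l, h l * a l)
  have hb : ∀ h, ‖b h‖ ^ 2 = ∏ l, v l (h l) ^ 2 := fun h => by
    simp [b, norm_prod, ← prod_pow]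
  have hcard : (#H : ℝ) = (L : ℝ) ^ n := by simp [H]
  have hsum : ∏ l, ∑ j ∈ range L, v l j ^ 2 = ∑ h ∈ H, ‖b h‖ ^ 2 := by
    simp_rw [hb]
    exact prod_univ_sum _ _
  have hu : ∀ k : ℕ,
      ∏ l, ‖∑ j ∈ range L, (v l j : ℂ) * unitExp (j * (k * a l - y l))‖ ^ 2 =
        ‖∑ h ∈ H, b h * ζ h ^ k‖ ^ 2 := fun k => by
    rw [prod_pow, ← norm_prod, prod_univ_sum]
    congr 2
    refine sum_congr rfl fun h _ => ?_
    simp only [b, ζ]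
    rw [← unitExp_nat_mul, mul_sum, unitExp_sum, ← prod_mul_distrib]
    refine prod_congr rfl fun l _ => ?_
    rw [mul_assoc, ← unitExp_add]
    ring_nf
  simp_rw [hu]
  rw [hsum, ← hcard]
  refine abs_sum_normSq_sub_le H b ζ N (by positivity) (fun h => norm_unitExp _) ?_
  intro h hh h' hh' hne
  have hν : (fun l => (h l : ℤ) - h' l) ≠ 0 := by
    intro h0
    refine hne (funext fun l => ?_)
    have := congrFun h0 l
    simp only [Pi.zero_apply] at this
    omega
  have hR : ∑ l, |(((h l : ℤ) - h' l : ℤ) : ℝ)| ≤ n * L := by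
    have : ∀ l ∈ (univ : Finset (Fin n)), |(((h l : ℤ) - h' l : ℤ) : ℝ)| ≤ L := fun l _ => by
      have h1 : h l < L := mem_range.mp (Fintype.mem_piFinset.mp hh l)
      have h2 : h' l < L := mem_range.mp (Fintype.mem_piFinset.mp hh' l)
      have h3 : |(h l : ℤ) - h' l| ≤ L := by
        rw [abs_le]
        omega
      exact_mod_cast h3
    simpa using sum_le_card_nsmul _ _ _ this
  have hζ : ζ h * (starRingEnd ℂ) (ζ h') =
      unitExp (∑ l, a l * (((h l : ℤ) - h' l : ℤ) : ℝ)) := by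
    simp only [ζ]
    rw [conj_unitExp, ← unitExp_add, ← sub_eq_add_neg, ← sum_sub_distrib]
    congr 1
    refine sum_congr rfl fun l _ => ?_
    push_cast
    ring
  rw [hζ]
  exact ha.norm_geom_sum_le hc hν hR N

lemma sum_parabola_sq (L : ℕ) :
    ∑ j ∈ range L, ((j : ℝ) * (L - j)) ^ 2 = ((L : ℝ) ^ 5 - L) / 30 := by
  have h : ∀ (m : ℕ) (X : ℝ), ∑ j ∈ range m, ((j : ℝ) * (X - j)) ^ 2 =
      X ^ 2 * ((m - 1) * m * (2 * m - 1) / 6) - 2 * X * ((m - 1) ^ 2 * m ^ 2 / 4) +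
        (m - 1) * m * (2 * m - 1) * (3 * m ^ 2 - 3 * m - 1) / 30 := fun m X => by
    induction m with
    | zero => simp
    | succ m ih =>
      rw [sum_range_succ, ih]
      push_cast
      ring
  rw [h]
  ring

lemma sum_parabola_diff_sq (L : ℕ) :
    ∑ j ∈ range L, ((L : ℝ) - 1 - 2 * j) ^ 2 = ((L : ℝ) ^ 3 - L) / 3 := by
  have h : ∀ (m : ℕ) (X : ℝ), ∑ j ∈ range m, (X - 1 - 2 * j) ^ 2 =
      m * (X - 1) ^ 2 - 2 * (X - 1) * (m * (m - 1)) + 4 * ((m - 1) * m * (2 * m - 1) / 6) :=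
    fun m X => by
      induction m with
      | zero => simp
      | succ m ih =>
        rw [sum_range_succ, ih]
        push_cast
        ring
  rw [h]
  ring

/-- Summation by parts for a trigonometric polynomial whose weight vanishes at both ends. -/
lemma norm_sum_diff_mul_unitExp (w : ℕ → ℝ) (L : ℕ) (h0 : w 0 = 0) (hL : w L = 0) (t : ℝ) :
    ‖∑ j ∈ range L, ((w (j + 1) - w j : ℝ) : ℂ) * unitExp (j * t)‖ =
      ‖unitExp t - 1‖ * ‖∑ j ∈ range L, (w j : ℂ) * unitExp (j * t)‖ := by
  have h1 : unitExp t * ∑ j ∈ range L, (w (j + 1) : ℂ) * unitExp (j * t) =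
      ∑ j ∈ range L, (w j : ℂ) * unitExp (j * t) := by
    have h2 := sum_range_succ (fun j : ℕ => (w j : ℂ) * unitExp (j * t)) L
    rw [sum_range_succ', h0, hL] at h2
    simp only [Complex.ofReal_zero, zero_mul, add_zero] at h2
    rw [← h2, mul_sum]
    refine sum_congr rfl fun j _ => ?_
    push_cast
    rw [add_mul, one_mul, unitExp_add]
    ring
  have h3 : unitExp t * ∑ j ∈ range L, ((w (j + 1) - w j : ℝ) : ℂ) * unitExp (j * t) =
      (1 - unitExp t) * ∑ j ∈ range L, (w j : ℂ) * unitExp (j * t) := by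
    push_cast
    simp_rw [sub_mul, sum_sub_distrib, mul_sub, h1, one_mul]
  have h4 := congrArg norm h3
  rwa [norm_mul, norm_mul, norm_unitExp, one_mul, norm_sub_rev] at h4

lemma prod_ite_mul {ι R : Type*} [Fintype ι] [DecidableEq ι] [CommMonoid R] (i : ι) (x : R)
    (f : ι → R) : ∏ l, ((if l = i then x else 1) * f l) = x * ∏ l, f l := by
  rw [prod_mul_distrib, prod_ite_eq']
  simp

/-- If `L` is large compared with `n / ε` and `N` is large compared with the off-diagonal
contribution, the orbit meets every closed `ε`-box. -/
lemma IsBAP.exists_abs_sub_round_le {n : ℕ} {c : ℝ} (hc : 0 < c) {q : ℕ} {a : Fin n → ℝ}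
    (ha : IsBAP c q a) {ε : ℝ} (hε : 0 < ε) (y : Fin n → ℝ) {L N : ℕ} (hL : 2 ≤ L)
    (hLε : 10 * n ≤ 8 * ε ^ 2 * ((L : ℝ) ^ 2 + 1))
    (hN : 3 * ((n * L : ℝ) ^ q / (2 * c) * (L : ℝ) ^ n) < N) :
    ∃ k ∈ Icc 1 N, ∀ i, |((k : ℝ) * a i - y i) - round ((k : ℝ) * a i - y i)| ≤ ε := by
  by_contra! hcon
  let w : ℕ → ℝ := fun j => j * (L - j)
  let s : ℝ → ℂ := fun t => ∑ j ∈ range L, (w j : ℂ) * unitExp (j * t)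
  let P : ℕ → ℝ := fun k => ∏ l, ‖s (k * a l - y l)‖ ^ 2
  have hL2 : (2 : ℝ) ≤ L := by exact_mod_cast hL
  set D : ℝ := 10 / ((L : ℝ) ^ 2 + 1) with hD
  set A : ℝ := ∏ _l : Fin n, ∑ j ∈ range L, w j ^ 2 with hA
  set B : ℝ := (n * L : ℝ) ^ q / (2 * c) * (L : ℝ) ^ n with hBdef
  have hApos : 0 < A := by
    refine prod_pos fun _ _ => ?_
    rw [sum_parabola_sq]
    have : (L : ℝ) ^ 5 - L = L * ((L : ℝ) ^ 2 - 1) * ((L : ℝ) ^ 2 + 1) := by ring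
    rw [this]
    have : 0 < (L : ℝ) ^ 2 - 1 := by nlinarith
    positivity
  have hB0 : 0 ≤ B := by positivity
  have hDsum : ∑ j ∈ range L, (w (j + 1) - w j) ^ 2 = D * ∑ j ∈ range L, w j ^ 2 := by
    rw [sum_parabola_sq, hD]
    have : ∀ j : ℕ, w (j + 1) - w j = L - 1 - 2 * j := fun j => by
      simp only [w]
      push_cast
      ring
    simp_rw [this]
    rw [sum_parabola_diff_sq]
    field_simp
    ring
  have hmain := ha.abs_sum_prod_normSq_sub_le hc y L N fun _ => w
  have hdiff : ∀ i, ∑ k ∈ Icc 1 N, ‖unitExp (k * a i - y i) - 1‖ ^ 2 * P k ≤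
      (N + B) * (D * A) := fun i => by
    have h := ha.abs_sum_prod_normSq_sub_le hc y L N
      fun l j => if l = i then w (j + 1) - w j else w j
    have h1 : ∏ l : Fin n, ∑ j ∈ range L, (if l = i then w (j + 1) - w j else w j) ^ 2 =
        D * A := by
      rw [hA, ← prod_ite_mul i]
      refine prod_congr rfl fun l _ => ?_
      by_cases hl : l = i
      · simpa [hl] using hDsum
      · simp [hl]
    have h2 : ∀ k : ℕ, ∏ l, ‖∑ j ∈ range L, ((if l = i then w (j + 1) - w j else w j : ℝ) : ℂ) *
        unitExp (j * (k * a l - y l))‖ ^ 2 = ‖unitExp (k * a i - y i) - 1‖ ^ 2 * P k := by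
      intro k
      rw [← prod_ite_mul i]
      refine prod_congr rfl fun l _ => ?_
      by_cases hl : l = i
      · subst hl
        simp only [if_true]
        rw [norm_sum_diff_mul_unitExp w L (by simp [w]) (by simp [w]), mul_pow]
      · simp [hl, s]
    simp_rw [h2] at h
    rw [h1, ← mul_assoc (_ / _), ← hBdef] at h
    linarith [(abs_le.mp h).2]
  have hP : ∑ k ∈ Icc 1 N, P k ≥ (N - B) * A := by
    rw [← hA, ← mul_assoc (_ / _), ← hBdef] at hmain
    linarith [(abs_le.mp hmain).1]
  have hle : 16 * ε ^ 2 * ∑ k ∈ Icc 1 N, P k ≤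
      ∑ i, ∑ k ∈ Icc 1 N, ‖unitExp (k * a i - y i) - 1‖ ^ 2 * P k := by
    rw [sum_comm, mul_sum]
    refine sum_le_sum fun k hk => ?_
    obtain ⟨i, hi⟩ := hcon k hk
    have hP0 : 0 ≤ P k := prod_nonneg fun _ _ => by positivity
    have h1 := four_mul_abs_sub_round_le (k * a i - y i)
    have h2 : 16 * ε ^ 2 ≤ ‖unitExp (k * a i - y i) - 1‖ ^ 2 := by nlinarith
    exact (mul_le_mul_of_nonneg_right h2 hP0).trans
      (single_le_sum (f := fun i => ‖unitExp (k * a i - y i) - 1‖ ^ 2 * P k)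
        (fun _ _ => by positivity) (mem_univ i))
  have hsum : ∑ i, ∑ k ∈ Icc 1 N, ‖unitExp (k * a i - y i) - 1‖ ^ 2 * P k ≤
      n * ((N + B) * (D * A)) := by
    simpa using sum_le_card_nsmul univ _ _ fun i _ => hdiff i
  have hnD : n * D ≤ 8 * ε ^ 2 := by
    rw [hD, ← mul_div_assoc, div_le_iff₀ (by positivity)]
    linarith
  have h1 : n * ((N + B) * (D * A)) ≤ 8 * ε ^ 2 * ((N + B) * A) := by
    have : 0 ≤ (N + B) * A := by positivity
    nlinarith
  have h2 : 16 * ε ^ 2 * ((N - B) * A) ≤ 16 * ε ^ 2 * ∑ k ∈ Icc 1 N, P k :=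
    mul_le_mul_of_nonneg_left hP (by positivity)
  have h3 : 0 < 8 * ε ^ 2 * A * (N - 3 * B) := by
    have : 0 < N - 3 * B := by linarith
    positivity
  nlinarith

lemma IsBAP.lt_one {n : ℕ} (hn : 1 ≤ n) {c : ℝ} {q : ℕ} {a : Fin n → ℝ} (ha : IsBAP c q a) :
    c < 1 := by
  have h := ha (Pi.single ⟨0, hn⟩ 1) (by simp)
  have h1 : ∑ i, |((Pi.single (⟨0, hn⟩ : Fin n) (1 : ℤ) : Fin n → ℤ) i : ℝ)| = 1 := by
    rw [Fintype.sum_eq_single ⟨0, hn⟩]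
    · simp
    · intro i hi
      simp [hi]
  rw [h1, one_pow, div_one] at h
  linarith [abs_sub_round (∑ i, a i * ((Pi.single (⟨0, hn⟩ : Fin n) (1 : ℤ) : Fin n → ℤ) i : ℝ))]

/-- For every `n ≥ 1` and `q ∈ ℕ` there is `C > 0`, depending only on `n` and `q`, such that
for every `c' > 0`, every `ε > 0` and every `(c',q)`-badly approximable `a ∈ ℝ^n`,
`T_a(ε) ≤ C (1/c')^n ε^{-((q+1)n(n+1)/2 + q ∑_{i=0}^{n-2} (i+1)(2n-i)/2)}`: the orbit
`a, 2a, …, Na` taken mod `ℤ^n` is `ε`-dense in `𝕋^n` for every `N` at least this bound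
(for `n = 1` the sum `∑_{i=0}^{n-2}(i+1)(2n-i)/2` is `0`). -/
theorem torus_orbit_eps_dense_uniform (n : ℕ) (hn : 1 ≤ n) (q : ℕ) :
    ∃ C > 0, ∀ c' : ℝ, 0 < c' → ∀ ε : ℝ, 0 < ε → ∀ a : Fin n → ℝ, IsBAP c' q a →
      ∀ N : ℕ,
      C * (1 / c') ^ n * ε ^ (-((((q + 1) * n * (n + 1) + q * ∑ i ∈ Finset.range (n - 1),
          (i + 1) * (2 * n - i) : ℕ) : ℝ) / 2)) ≤ (N : ℝ) →
      ∀ z : Fin n → AddCircle (1 : ℝ), ∃ k ∈ Finset.Icc 1 N,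
        dist (fun i => (((k : ℝ) * a i : ℝ) : AddCircle (1 : ℝ))) z ≤ ε := by
  have hn' : (1 : ℝ) ≤ n := by exact_mod_cast hn
  refine ⟨2 * (4 * (n : ℝ) ^ 2) ^ q * (4 * n) ^ n, by positivity, ?_⟩
  intro c hc ε hε a ha N hN z
  set K : ℕ := (q + 1) * n * (n + 1) + q * ∑ i ∈ Finset.range (n - 1), (i + 1) * (2 * n - i)
    with hK
  have hN0 : 0 < (N : ℝ) := lt_of_lt_of_le (by positivity) hN
  have hN1 : 1 ≤ N := by exact_mod_cast hN0
  rcases le_or_gt (1 / 2) ε with hε2 | hε2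
  · refine ⟨1, by simp [hN1], (dist_pi_le_iff hε.le).mpr fun i => ?_⟩
    rw [dist_eq_norm]
    refine (AddCircle.norm_le_half_period (1 : ℝ) one_ne_zero).trans ?_
    simpa using hε2
  have hy : ∀ i, ∃ t : ℝ, (t : AddCircle (1 : ℝ)) = z i := fun i =>
    QuotientAddGroup.mk_surjective (z i)
  choose y hy using hy
  set L : ℕ := ⌈2 * n / ε⌉₊ with hLdef
  have hLge : 2 * n / ε ≤ L := Nat.le_ceil _
  have hLlt : (L : ℝ) < 2 * n / ε + 1 := Nat.ceil_lt_add_one (by positivity)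
  have hLε : 2 * n ≤ ε * L := by
    rw [div_le_iff₀ hε] at hLge
    linarith
  have hL4 : (L : ℝ) ≤ 4 * n / ε := by
    have : 1 ≤ 2 * n / ε := by
      rw [le_div_iff₀ hε]
      linarith
    have h4 : 4 * n / ε = 2 * n / ε + 2 * n / ε := by ring
    linarith
  have hL2 : 2 ≤ L := by
    have : (2 : ℝ) ≤ L := by nlinarith
    exact_mod_cast this
  have hexp : n + q ≤ (K : ℝ) / 2 := by
    have h1 : 2 * (n + q) ≤ K := by
      have h2 : 2 * (n + q) ≤ (q + 1) * n * (n + 1) := by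
        have h3 : (n + q) ≤ (q + 1) * n := by nlinarith
        have h4 : 2 ≤ n + 1 := by omega
        calc 2 * (n + q) ≤ (n + 1) * ((q + 1) * n) := Nat.mul_le_mul h4 h3
          _ = _ := by ring
      omega
    have h5 : (2 * (n + q) : ℝ) ≤ K := by exact_mod_cast h1
    linarith
  have hpow : (1 / ε) ^ (n + q) ≤ ε ^ (-((K : ℝ) / 2)) := by
    rw [one_div, inv_pow, ← Real.rpow_natCast, ← Real.rpow_neg hε.le]
    refine Real.rpow_le_rpow_of_exponent_ge hε (by linarith) ?_
    push_cast
    linarith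
  have hcn : 1 / c ≤ (1 / c) ^ n :=
    le_self_pow₀ (by rw [le_div_iff₀ hc]; linarith [ha.lt_one hn]) (by omega)
  have hbound : 3 * ((n * L : ℝ) ^ q / (2 * c) * (L : ℝ) ^ n) < N := by
    have h1 : (n * L : ℝ) ^ q / (2 * c) * (L : ℝ) ^ n ≤
        (n * (4 * n / ε) : ℝ) ^ q / (2 * c) * (4 * n / ε) ^ n := by gcongr
    have h2 : (n * (4 * n / ε) : ℝ) ^ q / (2 * c) * (4 * n / ε) ^ n =
        (4 * (n : ℝ) ^ 2) ^ q * (4 * n) ^ n * (1 / c) * (1 / ε) ^ (n + q) / 2 := by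
      have : (n * (4 * n / ε) : ℝ) = 4 * (n : ℝ) ^ 2 / ε := by ring
      rw [this, div_pow, div_pow, pow_add, one_div_pow, one_div_pow]
      field_simp
    have h3 : (4 * (n : ℝ) ^ 2) ^ q * (4 * n) ^ n * (1 / c) * (1 / ε) ^ (n + q) ≤
        (4 * (n : ℝ) ^ 2) ^ q * (4 * n) ^ n * (1 / c) ^ n * ε ^ (-((K : ℝ) / 2)) := by gcongr
    have h4 : 0 < (4 * (n : ℝ) ^ 2) ^ q * (4 * n) ^ n * (1 / c) * (1 / ε) ^ (n + q) := by
      positivity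
    linarith
  obtain ⟨k, hk, hki⟩ := ha.exists_abs_sub_round_le hc hε y hL2 (by nlinarith) hbound
  refine ⟨k, hk, (dist_pi_le_iff hε.le).mpr fun i => ?_⟩
  rw [← hy i, dist_eq_norm, ← AddCircle.coe_sub, UnitAddCircle.norm_eq]
  exact hki i
end

section
/- Let n ≥ 2 and let b = (b_1, …, b_n) ∈ ℝ^n be (c',q)-badly approximable by rationals, with 0 < b_i ≤ b_1 ≤ 1 for all i = 1, …, n. Then the vector w = (b_2/b_1, …, b_n/b_1) ∈ ℝ^{n-1} is (c'/(n+1)^q, q)-badly approximable by rationals. -/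
open Finset

/-- Let `b = (b_1, …, b_n) ∈ ℝ^n` (`n = m + 2 ≥ 2`) be `(c',q)`-badly approximable by
rationals, with `0 < b_i ≤ b_1 ≤ 1` for all `i`. Then the vector
`w = (b_2/b_1, …, b_n/b_1) ∈ ℝ^{n-1}` is `(c'/(n+1)^q, q)`-badly approximable by
rationals. -/
theorem quotient_vector_isBAP (m : ℕ) (c' : ℝ) (hc' : 0 < c') (q : ℕ)
    (b : Fin (m + 2) → ℝ) (hb : IsBAP c' q b)
    (hpos : ∀ i, 0 < b i) (hle : ∀ i, b i ≤ b 0) (hb1 : b 0 ≤ 1) :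
    IsBAP (c' / ((m + 2 + 1 : ℕ) : ℝ) ^ q) q (fun i : Fin (m + 1) => b i.succ / b 0) := by
  intro ν hν
  have hb0 := hpos 0
  set z : ℝ := ∑ i : Fin (m + 1), b i.succ / b 0 * (ν i : ℝ) with hz
  set S : ℝ := ∑ i, |(ν i : ℝ)| with hS
  have hS1 : 1 ≤ S := by
    obtain ⟨i, hi⟩ := Function.ne_iff.mp hν
    calc (1 : ℝ) ≤ |(ν i : ℝ)| := by exact_mod_cast Int.one_le_abs hi
      _ ≤ S := Finset.single_le_sum (f := fun i => |(ν i : ℝ)|)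
          (fun j _ => abs_nonneg _) (Finset.mem_univ i)
  have hzS : |z| ≤ S := by
    refine (Finset.abs_sum_le_sum_abs _ _).trans (Finset.sum_le_sum fun i _ => ?_)
    rw [abs_mul, abs_of_pos (div_pos (hpos _) hb0)]
    exact mul_le_of_le_one_left (abs_nonneg _) ((div_le_one hb0).mpr (hle _))
  have hround : |(round z : ℝ)| ≤ S + 1 / 2 := by
    have h := abs_sub_round z
    rw [abs_le] at *
    constructor <;> linarith
  let μ : Fin (m + 2) → ℤ := Fin.cons (-round z) ν
  have hμ : μ ≠ 0 := fun h => hν (funext fun i => by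
    simpa [μ] using congrFun h i.succ)
  have hnorm : ∑ i, |(μ i : ℝ)| = |(round z : ℝ)| + S := by
    simp [Fin.sum_univ_succ, μ, hS]
  have hinner : ∑ i, b i * (μ i : ℝ) = b 0 * (z - round z) := by
    have hmul : b 0 * z = ∑ i : Fin (m + 1), b i.succ * (ν i : ℝ) := by
      rw [hz, Finset.mul_sum]
      refine Finset.sum_congr rfl fun i _ => ?_
      field_simp
    rw [mul_sub, hmul, Fin.sum_univ_succ]
    simp only [μ, Fin.cons_zero, Fin.cons_succ]
    push_cast
    ring
  have hbound : |(round z : ℝ)| + S ≤ ((m + 2 + 1 : ℕ) : ℝ) * S := by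
    have hm : (0 : ℝ) ≤ m * S := by positivity
    push_cast
    linarith
  have hnorm_pos : 0 < |(round z : ℝ)| + S := by positivity
  have key := hb μ hμ
  rw [hnorm, hinner] at key
  calc c' / ((m + 2 + 1 : ℕ) : ℝ) ^ q / S ^ q
      = c' / (((m + 2 + 1 : ℕ) : ℝ) * S) ^ q := by rw [div_div, mul_pow]
    _ ≤ c' / (|(round z : ℝ)| + S) ^ q := by gcongr
    _ < |b 0 * (z - round z) - round (b 0 * (z - round z))| := key
    _ ≤ |b 0 * (z - round z)| := by simpa using round_le (b 0 * (z - round z)) 0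
    _ ≤ |z - round z| := by
      rw [abs_mul, abs_of_pos hb0]
      exact mul_le_of_le_one_left (abs_nonneg _) hb1
end
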